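/- arXiv:1004.4873 — 5 statements merged into one kernel-verified Lean document; each statement's English description precedes it below -/
import Mathlib

section
/- Let ℓ be a local action on the open set D ⊆ ℝⁿ. Let (φₙ) be a sequence of absolutely continuous functions from [0,1] into D and let φ : [0,1] → D be absolutely continuous. Assume there is a finite constant M such that for every n the essential supremum of |φₙ′| on [0,1] is at most M, and assume φₙ → φ uniformly on [0,1]. Then liminf_{n→∞} ∫₀¹ ℓ(φₙ(α), φₙ′(α)) dα ≥ ∫₀¹ ℓ(φ(α), φ′(α)) dα. -/
open MeasureTheory Set Filter
open scoped RealInnerProductSpace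

abbrev Euc (n : ℕ) := EuclideanSpace ℝ (Fin n)

open scoped Topology

/-- Jensen's inequality for sublinear functions on an interval. -/
theorem ConvexOn.map_intervalIntegral_le_of_homogeneous {E : Type*} [NormedAddCommGroup E]
    [NormedSpace ℝ E] [CompleteSpace E] {p : E → ℝ} (hp : ConvexOn ℝ univ p) (hpc : Continuous p)
    (hhom : ∀ y, ∀ c : ℝ, 0 ≤ c → p (c • y) = c * p y) {a b : ℝ} (hab : a < b) {v : ℝ → E}
    (hv : IntervalIntegrable v volume a b)
    (hpv : IntervalIntegrable (fun s => p (v s)) volume a b) :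
    p (∫ s in a..b, v s) ≤ ∫ s in a..b, p (v s) := by
  rw [intervalIntegrable_iff_integrableOn_Ioc_of_le hab.le] at hv hpv
  have key := hp.map_set_average_le (μ := volume) (t := Ioc a b) hpc.continuousOn isClosed_univ
    (by simpa using hab) (by simp) (by simp) hv hpv
  have hvol : volume.real (Ioc a b) = b - a := by simp [hab.le]
  have hpos : 0 < b - a := sub_pos.2 hab
  rw [setAverage_eq, setAverage_eq, hvol, hhom _ _ (by positivity), smul_eq_mul] at key
  rw [intervalIntegral.integral_of_le hab.le, intervalIntegral.integral_of_le hab.le]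
  exact le_of_mul_le_mul_left key (by positivity)

/-- Composition of a function continuous and bounded on `K × closedBall 0 M` with curves taking
values in these sets is integrable. -/
theorem integrableOn_comp_of_continuousOn {E : Type*} [NormedAddCommGroup E]
    [NormedSpace ℝ E] [FiniteDimensional ℝ E] {D K : Set E} (hD : IsOpen D) (hKD : K ⊆ D)
    {ℓ : E → E → ℝ} (hℓ : ContinuousOn (fun p : E × E => ℓ p.1 p.2) (D ×ˢ univ)) {M C : ℝ}
    (hC : ∀ x ∈ K, ∀ y, ‖y‖ ≤ M → |ℓ x y| ≤ C) {I : Set ℝ} (hI : MeasurableSet I)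
    (hIfin : volume I ≠ ⊤) {u v : ℝ → E} (hu : ContinuousOn u I) (huK : ∀ s ∈ I, u s ∈ K)
    (hv : IntegrableOn v I) (hvM : ∀ᵐ s ∂(volume.restrict I), ‖v s‖ ≤ M) :
    IntegrableOn (fun s => ℓ (u s) (v s)) I := by
  borelize E
  have hsc : SecondCountableTopology E := (secondCountable_of_proper : _)
  have hmeas : Measurable ((D ×ˢ univ).indicator (fun p : E × E => ℓ p.1 p.2)) := by
    classical
    rw [← piecewise_eq_indicator]
    exact hℓ.measurable_piecewise continuousOn_const (hD.measurableSet.prod .univ)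
  have hpair : AEMeasurable (fun s => (u s, v s)) (volume.restrict I) :=
    (hu.aemeasurable hI).prodMk hv.aemeasurable
  have hcomp : AEStronglyMeasurable (fun s => ℓ (u s) (v s)) (volume.restrict I) := by
    refine ((hmeas.comp_aemeasurable hpair).congr ?_).aestronglyMeasurable
    filter_upwards [ae_restrict_mem hI] with s hs
    simp [hKD (huK s hs)]
  refine IntegrableOn.of_bound (lt_top_iff_ne_top.2 hIfin) hcomp C ?_
  filter_upwards [ae_restrict_mem hI, hvM] with s hs hvs
  exact hC _ (huK s hs) _ hvs

theorem MeasureTheory.IntegrableOn.intervalIntegrable_of_mem_Icc {E : Type*} [NormedAddCommGroup E]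
    {g : ℝ → E} {a b x y : ℝ} (hg : IntegrableOn g (Icc a b)) (hx : x ∈ Icc a b)
    (hy : y ∈ Icc a b) : IntervalIntegrable g volume x y :=
  (hg.mono_set (uIcc_subset_Icc hx hy)).intervalIntegrable

/-- If the masses on `[0, 1]` of the nonnegative functions `g k` are at most `b`, and their lower
densities at almost every point, in the limit along `l`, are at least `f`, then the integral of
`f` is at most `b`. -/
theorem integral_le_of_eventually_density_le {ι : Type*} {l : Filter ι} [l.NeBot]
    {g : ι → ℝ → ℝ} {f : ℝ → ℝ} {b : ℝ} (hf : ∀ t ∈ Icc (0 : ℝ) 1, 0 ≤ f t)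
    (hg : ∀ᶠ k in l, IntegrableOn (g k) (Icc 0 1)) (hg0 : ∀ᶠ k in l, ∀ t ∈ Icc (0 : ℝ) 1, 0 ≤ g k t)
    (hgb : ∀ᶠ k in l, ∫ t in (0 : ℝ)..1, g k t ≤ b)
    (hdens : ∀ᵐ t : ℝ, t ∈ Ioo (0 : ℝ) 1 → ∀ c < f t, ∀ᶠ h in 𝓝[>] (0 : ℝ),
      ∀ᶠ k in l, h * c ≤ ∫ s in t..(t + h), g k s) :
    ∫ t in (0 : ℝ)..1, f t ≤ b := by
  let F := Ultrafilter.of l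
  have hF : (F : Filter ι) ≤ l := Ultrafilter.of_le l
  replace hg : ∀ᶠ k in F, ∀ x ∈ Icc (0 : ℝ) 1, ∀ y ∈ Icc (0 : ℝ) 1,
      IntervalIntegrable (g k) volume x y := by
    filter_upwards [hF hg] with k hk x hx y hy
    exact hk.intervalIntegrable_of_mem_Icc hx hy
  replace hg0 := hF hg0
  have h0 : (0 : ℝ) ∈ Icc (0 : ℝ) 1 := by simp
  have h1 : (1 : ℝ) ∈ Icc (0 : ℝ) 1 := by simp
  have hmono : ∀ᶠ k in F, ∀ x ∈ Icc (0 : ℝ) 1, ∀ y ∈ Icc (0 : ℝ) 1, x ≤ y →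
      ∫ s in (0 : ℝ)..x, g k s ≤ ∫ s in (0 : ℝ)..y, g k s := by
    filter_upwards [hg, hg0] with k hk hk0 x hx y hy hxy
    rw [← sub_nonneg, intervalIntegral.integral_interval_sub_left (hk _ h0 _ hy) (hk _ h0 _ hx)]
    exact intervalIntegral.integral_nonneg hxy fun s hs => hk0 s ⟨hx.1.trans hs.1, hs.2.trans hy.2⟩
  have hlim : ∀ t, ∃ G ∈ Icc 0 b, t ∈ Icc (0 : ℝ) 1 →
      Tendsto (fun k => ∫ s in (0 : ℝ)..t, g k s) F (𝓝 G) := by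
    have hmem : ∀ t ∈ Icc (0 : ℝ) 1, ∀ᶠ k in F, ∫ s in (0 : ℝ)..t, g k s ∈ Icc 0 b := by
      intro t ht
      filter_upwards [hmono, hF hgb] with k hk hkb
      refine ⟨?_, (hk t ht 1 h1 ht.2).trans hkb⟩
      simpa using hk 0 h0 t ht ht.1
    have hmem' : ∀ t ∈ Icc (0 : ℝ) 1, ∃ G ∈ Icc 0 b,
        Tendsto (fun k => ∫ s in (0 : ℝ)..t, g k s) F (𝓝 G) := fun t ht =>
      isCompact_Icc.ultrafilter_le_nhds' (F.map fun k => ∫ s in (0 : ℝ)..t, g k s) (hmem t ht)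
    intro t
    by_cases ht : t ∈ Icc (0 : ℝ) 1
    · obtain ⟨G, hG, hG'⟩ := hmem' t ht
      exact ⟨G, hG, fun _ => hG'⟩
    · obtain ⟨G, hG, -⟩ := hmem' 0 h0
      exact ⟨G, hG, fun h => absurd h ht⟩
  choose G hGb hG using hlim
  have hGmono : MonotoneOn G (Icc 0 1) := fun x hx y hy hxy =>
    le_of_tendsto_of_tendsto (hG x hx) (hG y hy) (hmono.mono fun k hk => hk x hx y hy hxy)
  have hGmono' : MonotoneOn G (uIcc 0 1) := by rwa [uIcc_of_le zero_le_one]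
  have hderiv : ∀ᵐ t : ℝ, t ∈ Ioo (0 : ℝ) 1 → f t ≤ deriv G t := by
    filter_upwards [hGmono.ae_differentiableWithinAt_of_mem, hdens] with t hd hdt ht
    have htI := Ioo_subset_Icc_self ht
    have hGd : HasDerivAt G (deriv G t) t :=
      ((hd htI).differentiableAt (Icc_mem_nhds ht.1 ht.2)).hasDerivAt
    refine le_of_forall_lt fun c hc => ?_
    obtain ⟨c', hcc', hc'⟩ := exists_between hc
    refine hcc'.trans_le ?_
    have hslope := hGd.tendsto_slope_zero_right
    refine ge_of_tendsto hslope ?_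
    have hsmall : ∀ᶠ h in 𝓝[>] (0 : ℝ), h < 1 - t :=
      nhdsWithin_le_nhds (Iio_mem_nhds (sub_pos.2 ht.2))
    filter_upwards [hdt ht c' hc', hsmall, self_mem_nhdsWithin] with h hh hh1 (hpos : 0 < h)
    have hthI : t + h ∈ Icc (0 : ℝ) 1 := ⟨by linarith [ht.1], by linarith⟩
    have hle : h * c' ≤ G (t + h) - G t := by
      refine ge_of_tendsto ((hG _ hthI).sub (hG _ htI)) ?_
      filter_upwards [hF hh, hg] with k hk hgk
      rwa [intervalIntegral.integral_interval_sub_left (hgk _ h0 _ hthI) (hgk _ h0 _ htI)]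
    rw [smul_eq_mul, inv_mul_eq_div, le_div_iff₀ hpos, mul_comm]
    exact hle
  have hint := hGmono'.intervalIntegrable_deriv
  have hG01 : G 0 ≤ G 1 := hGmono h0 h1 zero_le_one
  calc ∫ t in (0 : ℝ)..1, f t ≤ ∫ t in (0 : ℝ)..1, deriv G t := by
        rw [intervalIntegral.integral_of_le zero_le_one, intervalIntegral.integral_of_le zero_le_one,
          integral_Ioc_eq_integral_Ioo, integral_Ioc_eq_integral_Ioo]
        rw [intervalIntegrable_iff_integrableOn_Ioo_of_le zero_le_one] at hint
        refine integral_mono_of_nonneg ?_ hint ?_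
        · filter_upwards [ae_restrict_mem measurableSet_Ioo] with t ht
          exact hf t (Ioo_subset_Icc_self ht)
        · exact (ae_restrict_iff' measurableSet_Ioo).2 hderiv
    _ ≤ G 1 - G 0 := by
        have := hGmono'.intervalIntegral_deriv_mem_uIcc
        rw [uIcc_of_le (sub_nonneg.2 hG01)] at this
        exact this.2
    _ ≤ b := by linarith [(hGb 1).2, (hGb 0).1]

theorem continuousOn_of_eq_primitive {E : Type*} [NormedAddCommGroup E] [NormedSpace ℝ E]
    {φ φ' : ℝ → E} (hint : IntegrableOn φ' (Icc 0 1))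
    (hφ : ∀ t ∈ Icc (0 : ℝ) 1, φ t = φ 0 + ∫ s in (0 : ℝ)..t, φ' s) :
    ContinuousOn φ (Icc 0 1) := by
  have hI : uIcc (0 : ℝ) 1 = Icc 0 1 := uIcc_of_le zero_le_one
  refine ContinuousOn.congr (continuousOn_const.add ?_) hφ
  rw [← hI] at hint ⊢
  exact intervalIntegral.continuousOn_primitive_interval hint

theorem ae_hasDerivAt_of_eq_primitive {E : Type*} [NormedAddCommGroup E] [NormedSpace ℝ E]
    [CompleteSpace E] {φ φ' : ℝ → E} (hint : IntegrableOn φ' (Icc 0 1))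
    (hφ : ∀ t ∈ Icc (0 : ℝ) 1, φ t = φ 0 + ∫ s in (0 : ℝ)..t, φ' s) :
    ∀ᵐ t : ℝ, t ∈ Ioo (0 : ℝ) 1 → HasDerivAt φ (φ' t) t := by
  have hI : uIcc (0 : ℝ) 1 = Icc 0 1 := uIcc_of_le zero_le_one
  have hint' : IntervalIntegrable φ' volume 0 1 :=
    (hI.symm ▸ hint : IntegrableOn φ' (uIcc 0 1)).intervalIntegrable
  filter_upwards [hint'.ae_hasDerivAt_integral] with t ht htI
  have h := ht (hI ▸ Ioo_subset_Icc_self htI) 0 left_mem_uIcc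
  refine (h.const_add (φ 0)).congr_of_eventuallyEq ?_
  filter_upwards [Icc_mem_nhds htI.1 htI.2] with s hs using hφ s hs

/-- The action of uniformly close curves bounds from below, on short intervals, the local action
of the derivative of the limit curve. -/
theorem eventually_mul_le_integral_action {E : Type*} [NormedAddCommGroup E] [NormedSpace ℝ E]
    [FiniteDimensional ℝ E] {D : Set E} (hD : IsOpen D) {ℓ : E → E → ℝ}
    (hℓcont : ContinuousOn (fun p : E × E => ℓ p.1 p.2) (D ×ˢ univ))
    (hℓhom : ∀ x ∈ D, ∀ y : E, ∀ c : ℝ, 0 ≤ c → ℓ x (c • y) = c * ℓ x y)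
    (hℓconv : ∀ x ∈ D, ConvexOn ℝ univ (fun y => ℓ x y))
    {ι : Type*} {l : Filter ι} {φ φ' : ι → ℝ → E} {ψ : ℝ → E} {M : ℝ}
    (hint : ∀ k, IntegrableOn (φ' k) (Icc 0 1))
    (hφ : ∀ k, ∀ t ∈ Icc (0 : ℝ) 1, φ k t = φ k 0 + ∫ s in (0 : ℝ)..t, φ' k s)
    (hM : ∀ k, ∀ᵐ s ∂(volume.restrict (Icc (0 : ℝ) 1)), ‖φ' k s‖ ≤ M)
    (hunif : TendstoUniformlyOn φ ψ l (Icc 0 1))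
    (haction : ∀ᶠ k in l, IntegrableOn (fun s => ℓ (φ k s) (φ' k s)) (Icc 0 1))
    {t : ℝ} (ht : t ∈ Ioo (0 : ℝ) 1) (hψt : ψ t ∈ D)
    (hfrozen : ∀ k, IntegrableOn (fun s => ℓ (ψ t) (φ' k s)) (Icc 0 1))
    {w : E} (hψ' : HasDerivAt ψ w t) {c : ℝ} (hc : c < ℓ (ψ t) w) :
    ∀ᶠ h in 𝓝[>] (0 : ℝ), ∀ᶠ k in l, h * c ≤ ∫ s in t..(t + h), ℓ (φ k s) (φ' k s) := by
  obtain ⟨c', hcc', hc'⟩ := exists_between hc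
  have hε : 0 < c' - c := sub_pos.2 hcc'
  have hcont : Continuous (ℓ (ψ t)) := by
    rw [← continuousOn_univ]
    exact hℓcont.comp (f := fun y => (ψ t, y)) (by fun_prop) fun y _ => ⟨hψt, mem_univ _⟩
  have hnear : ∀ᶠ x in 𝓝 (ψ t), ∀ y ∈ Metric.closedBall (0 : E) M,
      ℓ (ψ t) y ≤ ℓ x y + (c' - c) := by
    refine (isCompact_closedBall (0 : E) M).eventually_forall_of_forall_eventually fun y _ => ?_
    have h1 : ContinuousAt (fun p : E × E => ℓ p.1 p.2) (ψ t, y) :=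
      hℓcont.continuousAt ((hD.prod isOpen_univ).mem_nhds ⟨hψt, mem_univ _⟩)
    have h2 : ContinuousAt (fun p : E × E => ℓ (ψ t) p.2) (ψ t, y) :=
      (hcont.comp continuous_snd).continuousAt
    filter_upwards [h2.eventually_lt (h1.add continuousAt_const)
      (show ℓ (ψ t) y < ℓ (ψ t) y + (c' - c) by linarith)] with z hz using hz.le
  obtain ⟨δ, hδ, hnear⟩ := Metric.eventually_nhds_iff.1 hnear
  obtain ⟨η, hη, hψη⟩ := Metric.continuousAt_iff.1 hψ'.continuousAt (δ / 2) (half_pos hδ)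
  have hslope : ∀ᶠ h in 𝓝[>] (0 : ℝ), c' < ℓ (ψ t) (h⁻¹ • (ψ (t + h) - ψ t)) :=
    ((hcont.tendsto w).comp hψ'.tendsto_slope_zero_right).eventually_const_lt hc'
  have hsmall : ∀ᶠ h in 𝓝[>] (0 : ℝ), h < 1 - t :=
    nhdsWithin_le_nhds (Iio_mem_nhds (sub_pos.2 ht.2))
  have hsmall' : ∀ᶠ h in 𝓝[>] (0 : ℝ), h < η := nhdsWithin_le_nhds (Iio_mem_nhds hη)
  have htI := Ioo_subset_Icc_self ht
  filter_upwards [hslope, hsmall, hsmall', self_mem_nhdsWithin] with h hh hh1 hhη (hpos : 0 < h)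
  have hthI : t + h ∈ Icc (0 : ℝ) 1 := ⟨by linarith [ht.1], by linarith⟩
  have hlt : t < t + h := by linarith
  have hsub : Icc t (t + h) ⊆ Icc 0 1 := Icc_subset_Icc htI.1 hthI.2
  have hlim : Tendsto (fun k => ℓ (ψ t) (h⁻¹ • (φ k (t + h) - φ k t))) l
      (𝓝 (ℓ (ψ t) (h⁻¹ • (ψ (t + h) - ψ t)))) :=
    (hcont.tendsto _).comp (((hunif.tendsto_at hthI).sub (hunif.tendsto_at htI)).const_smul _)
  filter_upwards [hlim.eventually_const_lt hh, haction,
    Metric.tendstoUniformlyOn_iff.1 hunif (δ / 2) (half_pos hδ)] with k hk hact hclose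
  have h0 : (0 : ℝ) ∈ Icc (0 : ℝ) 1 := by simp
  have hincr : φ k (t + h) - φ k t = ∫ s in t..(t + h), φ' k s := by
    rw [hφ k _ hthI, hφ k _ htI, add_sub_add_left_eq_sub,
      intervalIntegral.integral_interval_sub_left ((hint k).intervalIntegrable_of_mem_Icc h0 hthI)
        ((hint k).intervalIntegrable_of_mem_Icc h0 htI)]
  rw [hℓhom _ hψt _ _ (inv_nonneg.2 hpos.le), hincr, inv_mul_eq_div, lt_div_iff₀ hpos] at hk
  have hjensen := (hℓconv _ hψt).map_intervalIntegral_le_of_homogeneous hcont (hℓhom _ hψt) hlt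
    ((hint k).intervalIntegrable_of_mem_Icc htI hthI) ((hfrozen k).intervalIntegrable_of_mem_Icc htI hthI)
  have hcompare : ∫ s in t..(t + h), ℓ (ψ t) (φ' k s) ≤
      ∫ s in t..(t + h), (ℓ (φ k s) (φ' k s) + (c' - c)) := by
    refine intervalIntegral.integral_mono_ae_restrict hlt.le ((hfrozen k).intervalIntegrable_of_mem_Icc htI hthI)
      ((hact.intervalIntegrable_of_mem_Icc htI hthI).add intervalIntegrable_const) ?_
    filter_upwards [ae_restrict_mem measurableSet_Icc,
      ae_restrict_of_ae_restrict_of_subset hsub (hM k)] with s hs hsM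
    refine hnear ?_ _ (by simpa using hsM)
    have hsη : dist s t < η := by
      rw [Real.dist_eq, abs_lt]
      constructor <;> linarith [hs.1, hs.2]
    have hd1 := hclose s (hsub hs)
    rw [dist_comm] at hd1
    linarith [dist_triangle (φ k s) (ψ s) (ψ t), hψη hsη]
  rw [intervalIntegral.integral_add (hact.intervalIntegrable_of_mem_Icc htI hthI) intervalIntegrable_const,
    intervalIntegral.integral_const, add_sub_cancel_left, smul_eq_mul] at hcompare
  linarith

/-- lower semi-continuity of the geometric action along a uniformly
converging sequence of absolutely continuous curves with uniformly essentially
bounded derivatives. -/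
theorem statement0 {n : ℕ} (D : Set (Euc n)) (hD : IsOpen D) (hDne : D.Nonempty)
    (ℓ : Euc n → Euc n → ℝ)
    (hℓcont : ContinuousOn (fun p : Euc n × Euc n => ℓ p.1 p.2) (D ×ˢ Set.univ))
    (hℓnonneg : ∀ x ∈ D, ∀ y : Euc n, 0 ≤ ℓ x y)
    (hℓhom : ∀ x ∈ D, ∀ y : Euc n, ∀ c : ℝ, 0 ≤ c → ℓ x (c • y) = c * ℓ x y)
    (hℓconv : ∀ x ∈ D, ConvexOn ℝ Set.univ (fun y => ℓ x y))
    (φ φ' : ℕ → ℝ → Euc n) (ψ ψ' : ℝ → Euc n)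
    (hφAC : ∀ k, IntegrableOn (φ' k) (Icc 0 1) ∧
      ∀ t ∈ Icc (0:ℝ) 1, φ k t = φ k 0 + ∫ s in (0:ℝ)..t, φ' k s)
    (hφD : ∀ k, ∀ t ∈ Icc (0:ℝ) 1, φ k t ∈ D)
    (hψAC : IntegrableOn ψ' (Icc 0 1) ∧
      ∀ t ∈ Icc (0:ℝ) 1, ψ t = ψ 0 + ∫ s in (0:ℝ)..t, ψ' s)
    (hψD : ∀ t ∈ Icc (0:ℝ) 1, ψ t ∈ D)
    (M : ℝ)
    (hM : ∀ k, ∀ᵐ α ∂(volume.restrict (Icc (0:ℝ) 1)), ‖φ' k α‖ ≤ M)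
    (hunif : TendstoUniformlyOn (fun k t => φ k t) ψ atTop (Icc 0 1)) :
    ∫ α in (0:ℝ)..1, ℓ (ψ α) (ψ' α) ≤
      liminf (fun k => ∫ α in (0:ℝ)..1, ℓ (φ k α) (φ' k α)) atTop := by
  have hψcont := continuousOn_of_eq_primitive hψAC.1 hψAC.2
  have hφcont k := continuousOn_of_eq_primitive (hφAC k).1 (hφAC k).2
  have himage : IsCompact (ψ '' Icc 0 1) := isCompact_Icc.image_of_continuousOn hψcont
  obtain ⟨δ, hδ, hKD⟩ := himage.exists_cthickening_subset_open hD (image_subset_iff.2 hψD)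
  set K := Metric.cthickening δ (ψ '' Icc 0 1) with hK
  have hψK : ∀ t ∈ Icc (0 : ℝ) 1, ψ t ∈ K := fun t ht =>
    Metric.self_subset_cthickening _ (mem_image_of_mem ψ ht)
  have hφK : ∀ᶠ k in atTop, ∀ t ∈ Icc (0 : ℝ) 1, φ k t ∈ K := by
    filter_upwards [Metric.tendstoUniformlyOn_iff.1 hunif δ hδ] with k hk t ht
    refine Metric.mem_cthickening_of_dist_le _ _ _ _ (mem_image_of_mem ψ ht) ?_
    rw [dist_comm]
    exact (hk t ht).le
  obtain ⟨C, hC⟩ : ∃ C, ∀ x ∈ K, ∀ y, ‖y‖ ≤ M → |ℓ x y| ≤ C := by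
    have hcpt : IsCompact (K ×ˢ Metric.closedBall (0 : Euc n) M) :=
      himage.cthickening.prod (isCompact_closedBall _ _)
    obtain ⟨C, hC⟩ := hcpt.exists_bound_of_continuousOn
      (hℓcont.mono (prod_mono hKD (subset_univ _)))
    exact ⟨C, fun x hx y hy => hC (x, y) ⟨hx, by simpa using hy⟩⟩
  have hfrozen : ∀ t ∈ Icc (0 : ℝ) 1, ∀ k, IntegrableOn (fun s => ℓ (ψ t) (φ' k s)) (Icc 0 1) :=
    fun t ht k => integrableOn_comp_of_continuousOn hD hKD hℓcont hC measurableSet_Icc (by simp)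
      continuousOn_const (fun _ _ => hψK t ht) (hφAC k).1 (hM k)
  have haction : ∀ᶠ k in atTop, IntegrableOn (fun s => ℓ (φ k s) (φ' k s)) (Icc 0 1) := by
    filter_upwards [hφK] with k hk
    exact integrableOn_comp_of_continuousOn hD hKD hℓcont hC measurableSet_Icc (by simp)
      (hφcont k) hk (hφAC k).1 (hM k)
  have hbdd : IsBoundedUnder (· ≤ ·) atTop
      (fun k => ∫ α in (0 : ℝ)..1, ℓ (φ k α) (φ' k α)) := by
    refine ⟨C, eventually_map.2 ?_⟩
    filter_upwards [hφK] with k hk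
    refine (Real.le_norm_self _).trans ?_
    have hae : ∀ᵐ s : ℝ, s ∈ uIoc (0 : ℝ) 1 → ‖ℓ (φ k s) (φ' k s)‖ ≤ C := by
      filter_upwards [(ae_restrict_iff' measurableSet_Icc).1 (hM k)] with s hs hsI
      rw [uIoc_of_le zero_le_one] at hsI
      have hsI' := Ioc_subset_Icc_self hsI
      exact hC _ (hk s hsI') _ (hs hsI')
    simpa using intervalIntegral.norm_integral_le_of_norm_le_const_ae hae
  by_contra! hlt
  obtain ⟨b, hb, hb'⟩ := exists_between hlt
  have hfreq := frequently_lt_of_liminf_lt hbdd.isCoboundedUnder_ge hb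
  set S := {k | ∫ α in (0 : ℝ)..1, ℓ (φ k α) (φ' k α) < b}
  have : (atTop ⊓ 𝓟 S).NeBot := frequently_mem_iff_neBot.1 hfreq
  refine hb'.not_ge (integral_le_of_eventually_density_le (l := atTop ⊓ 𝓟 S)
    (g := fun k s => ℓ (φ k s) (φ' k s)) (fun t ht => hℓnonneg _ (hψD t ht) _)
    (haction.filter_mono inf_le_left) (.of_forall fun k t ht => hℓnonneg _ (hφD k t ht) _)
    ((eventually_principal.2 fun k hk => le_of_lt hk).filter_mono inf_le_right) ?_)
  filter_upwards [ae_hasDerivAt_of_eq_primitive hψAC.1 hψAC.2] with t hψt ht c hc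
  have htI := Ioo_subset_Icc_self ht
  filter_upwards [eventually_mul_le_integral_action hD hℓcont hℓhom hℓconv
    (fun k => (hφAC k).1) (fun k => (hφAC k).2) hM hunif haction ht (hψD t htI)
    (hfrozen t htI) (hψt ht) hc] with h hh
  exact hh.filter_mono inf_le_left
end

section
/- Let D ⊆ ℝⁿ be open and let H : D × ℝⁿ → ℝ be continuous and satisfy (H1)–(H3). Then: (a) for every compact K ⊆ D there is R > 0 such that {θ ∈ ℝⁿ : H(x,θ) ≤ 0} ⊆ closedBall(0,R) for every x ∈ K; (b) the function ℓ(x,y) := sup{⟨y,θ⟩ : θ ∈ ℝⁿ, H(x,θ) ≤ 0} is finite and nonnegative on D × ℝⁿ, satisfies ℓ(x, c•y) = c·ℓ(x,y) for all c ≥ 0, is convex in y for each fixed x, and is continuous on D × ℝⁿ; (c) for every x ∈ D and y ∈ ℝⁿ both suprema sup{⟨y,θ⟩ : H(x,θ) ≤ 0} and sup{⟨y,θ⟩ : H(x,θ) = 0} are attained and are equal. -/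
open MeasureTheory Set Filter
open scoped RealInnerProductSpace

open scoped Topology

section StronglyConvex

variable {E : Type*} [NormedAddCommGroup E] [InnerProductSpace ℝ E] [CompleteSpace E]
  {f : E → ℝ} {f' : E → E} {f'' : E → E →L[ℝ] E} {m : ℝ}

theorem quadratic_lower_bound (hf : ∀ θ, HasGradientAt f (f' θ) θ)
    (hf' : ∀ θ, HasFDerivAt f' (f'' θ) θ) (hm : ∀ θ ξ, m * ‖ξ‖ ^ 2 ≤ ⟪ξ, f'' θ ξ⟫) (a b : E) :
    f a + ⟪f' a, b - a⟫ + m / 2 * ‖b - a‖ ^ 2 ≤ f b := by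
  set v := b - a with hv
  have hline : ∀ t : ℝ, HasDerivAt (fun t : ℝ => a + t • v) v t := fun t => by
    simpa using ((hasDerivAt_id t).smul_const v).const_add a
  have h1 : ∀ t : ℝ, HasDerivAt (fun t : ℝ => f (a + t • v)) ⟪f' (a + t • v), v⟫ t := fun t => by
    simpa [Function.comp_def] using
      ((hf (a + t • v)).hasFDerivAt).comp_hasDerivAt t (hline t)
  have h2 : ∀ t : ℝ, HasDerivAt (fun t : ℝ => ⟪f' (a + t • v), v⟫) ⟪f'' (a + t • v) v, v⟫ t :=
    fun t => by
      simpa using ((hf' (a + t • v)).comp_hasDerivAt t (hline t)).inner ℝ (hasDerivAt_const t v)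
  have hslope : Monotone fun t : ℝ => ⟪f' (a + t • v), v⟫ - t * (m * ‖v‖ ^ 2) := by
    refine monotone_of_hasDerivAt_nonneg
      (fun t => (h2 t).sub ((hasDerivAt_id t).mul_const (m * ‖v‖ ^ 2))) fun t => ?_
    have := hm (a + t • v) v
    rw [real_inner_comm] at this
    simpa using this
  have hrem : ∀ t : ℝ, HasDerivAt
      (fun t : ℝ => f (a + t • v) - t * ⟪f' a, v⟫ - t ^ 2 * (m / 2 * ‖v‖ ^ 2))
      (⟪f' (a + t • v), v⟫ - ⟪f' a, v⟫ - t * (m * ‖v‖ ^ 2)) t := fun t => by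
    refine (((h1 t).sub ((hasDerivAt_id t).mul_const ⟪f' a, v⟫)).sub
      ((hasDerivAt_pow 2 t).mul_const (m / 2 * ‖v‖ ^ 2))).congr_deriv ?_
    push_cast
    ring
  obtain ⟨t, ht, h⟩ := exists_hasDerivAt_eq_slope _ _ zero_lt_one
    (HasDerivAt.continuousOn fun t _ => hrem t) fun t _ => hrem t
  have := hslope ht.1.le
  have hb : a + v = b := by simp [hv]
  simp [hb] at h this
  linarith

theorem strictConvexOn_of_hessian_bound (hf : ∀ θ, HasGradientAt f (f' θ) θ)
    (hf' : ∀ θ, HasFDerivAt f' (f'' θ) θ) (hm0 : 0 < m)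
    (hm : ∀ θ ξ, m * ‖ξ‖ ^ 2 ≤ ⟪ξ, f'' θ ξ⟫) : StrictConvexOn ℝ univ f := by
  refine ⟨convex_univ, fun x _ y _ hxy a b ha hb hab => ?_⟩
  have hx := quadratic_lower_bound hf hf' hm (a • x + b • y) x
  have hy := quadratic_lower_bound hf hf' hm (a • x + b • y) y
  obtain rfl : a = 1 - b := by linarith
  have ex : x - ((1 - b) • x + b • y) = b • (x - y) := by module
  have ey : y - ((1 - b) • x + b • y) = -(1 - b) • (x - y) := by module
  rw [ex, inner_smul_right] at hx
  rw [ey, inner_smul_right] at hy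
  have px : 0 < m / 2 * ‖b • (x - y)‖ ^ 2 := by
    have := norm_pos_iff.2 (smul_ne_zero hb.ne' (sub_ne_zero.2 hxy))
    positivity
  have py : 0 ≤ m / 2 * ‖-(1 - b) • (x - y)‖ ^ 2 := by positivity
  simp only [smul_eq_mul]
  nlinarith [mul_le_mul_of_nonneg_left hx ha.le, mul_le_mul_of_nonneg_left hy hb.le,
    mul_pos ha px, mul_nonneg hb.le py]

end StronglyConvex

/-- A continuous function whose nonpositive set is bounded vanishes somewhere on each ray that
starts in that set. -/
theorem exists_zero_on_ray {E : Type*} [NormedAddCommGroup E] [NormedSpace ℝ E] {f : E → ℝ}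
    (hf : Continuous f) {R : ℝ} (hR : {θ | f θ ≤ 0} ⊆ Metric.closedBall 0 R) {θ v : E}
    (hθ : f θ ≤ 0) (hv : v ≠ 0) : ∃ t : ℝ, 0 ≤ t ∧ f (θ + t • v) = 0 := by
  have hv' := norm_pos_iff.2 hv
  have hR0 : ‖θ‖ ≤ R := by simpa using hR hθ
  set T : ℝ := (2 * R + 1) / ‖v‖
  have hT : 0 ≤ T := div_nonneg (by linarith [norm_nonneg θ]) hv'.le
  have hpos : 0 ≤ f (θ + T • v) := by
    by_contra! h
    have h1 : ‖θ + T • v‖ ≤ R := by simpa using hR h.le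
    have h2 : ‖T • v‖ = 2 * R + 1 := by
      rw [norm_smul, Real.norm_of_nonneg hT, div_mul_cancel₀ _ hv'.ne']
    have h3 : ‖T • v‖ ≤ ‖θ + T • v‖ + ‖θ‖ := by
      simpa using norm_sub_le (θ + T • v) θ
    linarith
  obtain ⟨t, ht, h⟩ := intermediate_value_Icc (f := fun t : ℝ => f (θ + t • v)) hT
    (by fun_prop) (show (0 : ℝ) ∈ _ from ⟨by simpa using hθ, hpos⟩)
  exact ⟨t, ht.1, h⟩

/-- the Hamiltonian geometric local action
`ℓ(x,y) = sup {⟨y,θ⟩ : H(x,θ) ≤ 0}` is well defined (finite), nonnegative,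
positively homogeneous, convex in `y`, continuous, the sublevel sets of `H` are
uniformly bounded on compacts, and both the inequality- and equality-constrained
suprema are attained and agree. -/
theorem statement1 {n : ℕ} (hn : 0 < n)
    (D : Set (Euc n)) (hD : IsOpen D) (hDne : D.Nonempty)
    (H : Euc n → Euc n → ℝ)
    (Hθ : Euc n → Euc n → Euc n)
    (Hθθ : Euc n → Euc n → (Euc n →L[ℝ] Euc n))
    (hHcont : ContinuousOn (fun p : Euc n × Euc n => H p.1 p.2) (D ×ˢ Set.univ))
    (hH1 : ∀ x ∈ D, H x 0 ≤ 0)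
    (hHθ : ∀ x ∈ D, ∀ θ : Euc n, HasGradientAt (H x) (Hθ x θ) θ)
    (hHθθ : ∀ x ∈ D, ∀ θ : Euc n, HasFDerivAt (Hθ x) (Hθθ x θ) θ)
    (hHθcont : ContinuousOn (fun p : Euc n × Euc n => Hθ p.1 p.2) (D ×ˢ Set.univ))
    (hHθθcont : ContinuousOn (fun p : Euc n × Euc n => Hθθ p.1 p.2) (D ×ˢ Set.univ))
    (hH3 : ∀ K ⊆ D, IsCompact K → ∃ m > (0:ℝ), ∀ x ∈ K, ∀ θ ξ : Euc n,
      m * ‖ξ‖ ^ 2 ≤ ⟪ξ, Hθθ x θ ξ⟫)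
    (ℓ : Euc n → Euc n → ℝ)
    (hℓdef : ∀ x y : Euc n, ℓ x y = sSup ((fun θ => ⟪y, θ⟫) '' {θ | H x θ ≤ 0})) :
    (∀ K ⊆ D, IsCompact K → ∃ R > (0:ℝ), ∀ x ∈ K,
      {θ : Euc n | H x θ ≤ 0} ⊆ Metric.closedBall 0 R) ∧
    (∀ x ∈ D, ∀ y : Euc n, BddAbove ((fun θ => ⟪y, θ⟫) '' {θ | H x θ ≤ 0})) ∧
    (∀ x ∈ D, ∀ y : Euc n, 0 ≤ ℓ x y) ∧
    (∀ x ∈ D, ∀ y : Euc n, ∀ c : ℝ, 0 ≤ c → ℓ x (c • y) = c * ℓ x y) ∧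
    (∀ x ∈ D, ConvexOn ℝ Set.univ (fun y => ℓ x y)) ∧
    ContinuousOn (fun p : Euc n × Euc n => ℓ p.1 p.2) (D ×ˢ Set.univ) ∧
    (∀ x ∈ D, ∀ y : Euc n,
      (∃ θ : Euc n, H x θ ≤ 0 ∧ ⟪y, θ⟫ = ℓ x y) ∧
      (∃ θ : Euc n, H x θ = 0 ∧ ⟪y, θ⟫ = ℓ x y) ∧
      (∀ θ : Euc n, H x θ ≤ 0 → ⟪y, θ⟫ ≤ ℓ x y)) := by
  have hHx : ∀ x ∈ D, Continuous (H x) := fun x hx =>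
    continuous_iff_continuousAt.2 fun θ => (hHθ x hx θ).continuousAt
  have hHat : ∀ x ∈ D, ∀ θ, ContinuousAt (fun p : Euc n × Euc n => H p.1 p.2) (x, θ) :=
    fun x hx θ => hHcont.continuousAt ((hD.prod isOpen_univ).mem_nhds ⟨hx, mem_univ θ⟩)
  have hconv : ∀ x ∈ D, StrictConvexOn ℝ univ (H x) := fun x hx => by
    obtain ⟨m, hm0, hm⟩ := hH3 {x} (by simpa using hx) isCompact_singleton
    exact strictConvexOn_of_hessian_bound (hHθ x hx) (hHθθ x hx) hm0 (hm x rfl)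
  have hbdd : ∀ K ⊆ D, IsCompact K → ∃ R > (0:ℝ), ∀ x ∈ K,
      {θ : Euc n | H x θ ≤ 0} ⊆ Metric.closedBall 0 R := by
    intro K hKD hK
    obtain ⟨m, hm0, hm⟩ := hH3 K hKD hK
    have hzero : ContinuousOn (fun x : Euc n => (x, (0 : Euc n))) K := by fun_prop
    have hmaps : MapsTo (fun x : Euc n => (x, (0 : Euc n))) K (D ×ˢ univ) :=
      fun x hx => ⟨hKD hx, mem_univ _⟩
    obtain ⟨A, hA⟩ := hK.exists_bound_of_continuousOn (hHcont.comp hzero hmaps)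
    obtain ⟨B, hB⟩ := hK.exists_bound_of_continuousOn (hHθcont.comp hzero hmaps)
    refine ⟨2 * (|A| + |B|) / m + 1, by positivity, fun x hx θ hθ => ?_⟩
    have h0 := quadratic_lower_bound (hHθ x (hKD hx)) (hHθθ x (hKD hx)) (hm x hx) 0 θ
    have hA' := (abs_le.1 ((hA x hx).trans (le_abs_self A))).1
    have hB' := (hB x hx).trans (le_abs_self B)
    simp only [Function.comp_apply] at hA' hB'
    have hin := (abs_le.1 (abs_real_inner_le_norm (Hθ x 0) θ)).1
    have hBθ := mul_le_mul_of_nonneg_right hB' (norm_nonneg θ)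
    rw [mem_ofPred_eq] at hθ
    rw [sub_zero] at h0
    rw [mem_closedBall_zero_iff]
    by_contra! hlt
    have h1 : 1 < ‖θ‖ := lt_of_le_of_lt (le_add_of_nonneg_left (by positivity)) hlt
    have h2 : 2 * (|A| + |B|) < ‖θ‖ * m := (div_lt_iff₀ hm0).1 (by linarith)
    nlinarith [abs_nonneg A, mul_lt_mul_of_pos_right h2 (zero_lt_one.trans h1),
      mul_le_mul_of_nonneg_left h1.le (abs_nonneg A)]
  have hbddx : ∀ x ∈ D, ∃ R > (0:ℝ), {θ : Euc n | H x θ ≤ 0} ⊆ Metric.closedBall 0 R :=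
    fun x hx => by simpa using hbdd {x} (by simpa using hx) isCompact_singleton
  have hgreatest : ∀ x ∈ D, ∀ y : Euc n,
      IsGreatest ((fun θ => ⟪y, θ⟫) '' {θ | H x θ ≤ 0}) (ℓ x y) := by
    intro x hx y
    obtain ⟨R, -, hR⟩ := hbddx x hx
    have hcpt : IsCompact {θ : Euc n | H x θ ≤ 0} :=
      (isCompact_closedBall 0 R).of_isClosed_subset
        (isClosed_le (hHx x hx) continuous_const) hR
    rw [hℓdef]
    exact (hcpt.image (by fun_prop)).isGreatest_sSup ⟨_, mem_image_of_mem _ (hH1 x hx)⟩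
  have hle : ∀ x ∈ D, ∀ y θ : Euc n, H x θ ≤ 0 → ⟪y, θ⟫ ≤ ℓ x y := fun x hx y θ hθ =>
    (hgreatest x hx y).2 (mem_image_of_mem _ hθ)
  have hattained : ∀ x ∈ D, ∀ y : Euc n, ∃ θ : Euc n, H x θ ≤ 0 ∧ ⟪y, θ⟫ = ℓ x y :=
    fun x hx y => (hgreatest x hx y).1
  have hnonneg : ∀ x ∈ D, ∀ y : Euc n, 0 ≤ ℓ x y := fun x hx y => by
    simpa using hle x hx y 0 (hH1 x hx)
  refine ⟨hbdd, fun x hx y => (hgreatest x hx y).bddAbove, hnonneg, ?_, ?_, ?_, ?_⟩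
  · intro x hx y c hc
    obtain ⟨θ, hθ, h⟩ := hattained x hx (c • y)
    obtain ⟨θ', hθ', h'⟩ := hattained x hx y
    apply le_antisymm
    · rw [← h, real_inner_smul_left]
      exact mul_le_mul_of_nonneg_left (hle x hx y θ hθ) hc
    · rw [← h', ← real_inner_smul_left]
      exact hle x hx _ θ' hθ'
  · intro x hx
    refine ⟨convex_univ, fun y _ z _ a b ha hb _ => ?_⟩
    obtain ⟨θ, hθ, h⟩ := hattained x hx (a • y + b • z)
    simp only [← h, inner_add_left, real_inner_smul_left, smul_eq_mul]
    gcongr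
    · exact hle x hx y θ hθ
    · exact hle x hx z θ hθ
  · rintro ⟨x, y⟩ ⟨hx, -⟩
    apply ContinuousAt.continuousWithinAt
    have hfst : Tendsto Prod.fst (𝓝 (x, y)) (𝓝 x) := continuousAt_fst
    have hDev : ∀ᶠ p in 𝓝 (x, y), p.1 ∈ D := hfst (hD.mem_nhds hx)
    refine tendsto_order.2 ⟨fun a ha => ?_, fun a ha => ?_⟩
    · obtain ⟨θ, hθ, h⟩ := hattained x hx y
      by_cases hneg : ∃ θ₁, H x θ₁ < 0
      · obtain ⟨θ₁, hθ₁⟩ := hneg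
        have hcont : ContinuousAt (fun s : ℝ => ⟪y, (1 - s) • θ + s • θ₁⟫) 0 := by fun_prop
        have hev : ∀ᶠ s in 𝓝 (0 : ℝ), a < ⟪y, (1 - s) • θ + s • θ₁⟫ :=
          hcont.eventually (lt_mem_nhds (by simpa [h] using ha))
        obtain ⟨s, hs, hs0, hs1⟩ := ((hev.filter_mono nhdsWithin_le_nhds).and
          (Ioo_mem_nhdsGT (zero_lt_one (α := ℝ)))).exists
        have hlt : H x ((1 - s) • θ + s • θ₁) < 0 := by
          have := (hconv x hx).convexOn.2 (mem_univ θ) (mem_univ θ₁) (sub_nonneg.2 hs1.le)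
            hs0.le (by ring)
          simp only [smul_eq_mul] at this
          nlinarith [mul_nonneg (sub_nonneg.2 hs1.le) (neg_nonneg.2 hθ)]
        have hH : ∀ᶠ p in 𝓝 (x, y), H p.1 ((1 - s) • θ + s • θ₁) < 0 :=
          ((hHat x hx _).tendsto.comp (hfst.prodMk_nhds tendsto_const_nhds)).eventually
            (gt_mem_nhds hlt)
        have hin : ContinuousAt (fun p : Euc n × Euc n => ⟪p.2, (1 - s) • θ + s • θ₁⟫) (x, y) := by
          fun_prop
        filter_upwards [hDev, hH, hin.eventually (lt_mem_nhds hs)] with p hp h1 h2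
        exact h2.trans_le (hle _ hp _ _ h1.le)
      · push Not at hneg
        have hθ0 : θ = 0 := by
          by_contra hne
          have := (hconv x hx).2 (mem_univ θ) (mem_univ 0) hne (one_half_pos (α := ℝ))
            one_half_pos (by norm_num)
          simp only [smul_eq_mul] at this
          linarith [hneg ((1 / 2 : ℝ) • θ + (1 / 2 : ℝ) • 0), hH1 x hx]
        rw [hθ0, inner_zero_right] at h
        filter_upwards [hDev] with p hp
        exact (show a < 0 by rwa [h]).trans_le (hnonneg _ hp _)
    · obtain ⟨K, hK, hxK, hKD⟩ := exists_compact_subset hD hx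
      obtain ⟨R, -, hR⟩ := hbdd K hKD hK
      have hloc : ∀ θ ∈ Metric.closedBall (0 : Euc n) R,
          ∀ᶠ q : (Euc n × Euc n) × Euc n in 𝓝 ((x, y), θ),
            H q.1.1 q.2 ≤ 0 → ⟪q.1.2, q.2⟫ < a := by
        intro θ _
        rcases le_or_gt (H x θ) 0 with hθ | hθ
        · have hin : ContinuousAt (fun q : (Euc n × Euc n) × Euc n => ⟪q.1.2, q.2⟫)
              ((x, y), θ) := by fun_prop
          filter_upwards [hin.eventually (gt_mem_nhds ((hle x hx y θ hθ).trans_lt ha))]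
            with q hq _ using hq
        · have hc : Tendsto (fun q : (Euc n × Euc n) × Euc n => (q.1.1, q.2))
              (𝓝 ((x, y), θ)) (𝓝 (x, θ)) :=
            Continuous.tendsto (by fun_prop) _
          filter_upwards [((hHat x hx θ).tendsto.comp hc).eventually (lt_mem_nhds hθ)]
            with q hq hq' using absurd hq' (not_le.2 hq)
      filter_upwards [hfst (mem_interior_iff_mem_nhds.1 hxK),
        (isCompact_closedBall (0 : Euc n) R).eventually_forall_of_forall_eventually
          (P := fun p θ => H p.1 θ ≤ 0 → ⟪p.2, θ⟫ < a) hloc]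
        with p hp h
      obtain ⟨θ, hθ, hθ'⟩ := hattained p.1 (hKD hp) p.2
      rw [← hθ']
      exact h θ (hR _ hp hθ) hθ
  · intro x hx y
    obtain ⟨θ, hθ, h⟩ := hattained x hx y
    refine ⟨⟨θ, hθ, h⟩, ?_, hle x hx y⟩
    obtain ⟨v, hv, hyv⟩ : ∃ v : Euc n, v ≠ 0 ∧ 0 ≤ ⟪y, v⟫ := by
      by_cases hy : y = 0
      · have : Nonempty (Fin n) := ⟨⟨0, hn⟩⟩
        obtain ⟨v, hv⟩ := exists_ne (0 : Euc n)
        exact ⟨v, hv, by simp [hy]⟩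
      · exact ⟨y, hy, real_inner_self_nonneg⟩
    obtain ⟨R, -, hR⟩ := hbddx x hx
    obtain ⟨t, ht, hz⟩ := exists_zero_on_ray (hHx x hx) hR hθ hv
    refine ⟨_, hz, (hle x hx y _ hz.le).antisymm ?_⟩
    rw [inner_add_right, real_inner_smul_right, h]
    exact le_add_of_nonneg_right (mul_nonneg ht hyv)
end

section
/- Let D ⊆ ℝⁿ be open, let H : D × ℝⁿ → ℝ be continuous and satisfy (H1)–(H3), and let ℓ(x,y) := sup{⟨y,θ⟩ : θ ∈ ℝⁿ, H(x,θ) ≤ 0}. Then for every fixed x ∈ D and every y ∈ ℝⁿ with y ≠ 0, the system H_θ(x,θ̂) = λ·y, H(x,θ̂) = 0, λ ≥ 0 has exactly one solution (θ̂, λ) ∈ ℝⁿ × [0,∞), and for this solution ℓ(x,y) = ⟨y, θ̂⟩. -/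
open MeasureTheory Set Filter
open scoped RealInnerProductSpace

section StronglyConvex

variable {E : Type*} [NormedAddCommGroup E] [InnerProductSpace ℝ E]

/-- If the Hessian is bounded below by `m`, the function lies above its tangent paraboloids
of curvature `m`. -/
lemma tangent_paraboloid_le [CompleteSpace E] {h : E → ℝ} {g : E → E} {A : E → E →L[ℝ] E} {m : ℝ}
    (hg : ∀ θ, HasGradientAt h (g θ) θ) (hA : ∀ θ, HasFDerivAt g (A θ) θ)
    (hm : ∀ θ ξ : E, m * ‖ξ‖ ^ 2 ≤ ⟪ξ, A θ ξ⟫) (a b : E) :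
    h a + ⟪g a, b - a⟫ + m / 2 * ‖b - a‖ ^ 2 ≤ h b := by
  set v := b - a
  have hline (t : ℝ) : HasDerivAt (fun t : ℝ => a + t • v) v t := by
    simpa using ((hasDerivAt_id t).smul_const v).const_add a
  have hd1 (t : ℝ) : HasDerivAt (fun t : ℝ => h (a + t • v)) ⟪g (a + t • v), v⟫ t := by
    have := (hg (a + t • v)).hasFDerivAt.comp_hasDerivAt t (hline t)
    simpa [Function.comp_def] using this
  have hd2 (t : ℝ) : HasDerivAt (fun t : ℝ => ⟪g (a + t • v), v⟫) ⟪A (a + t • v) v, v⟫ t := by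
    have := ((hA (a + t • v)).comp_hasDerivAt t (hline t)).inner ℝ (hasDerivAt_const t v)
    simpa using this
  have hmono1 : Monotone (fun t : ℝ => ⟪g (a + t • v), v⟫ - t * (m * ‖v‖ ^ 2)) := by
    refine monotone_of_hasDerivAt_nonneg
      (fun t => (hd2 t).sub ((hasDerivAt_id t).mul_const (m * ‖v‖ ^ 2))) fun t => ?_
    have := hm (a + t • v) v
    rw [real_inner_comm] at this
    simpa using this
  have hd3 (t : ℝ) : HasDerivAt
      (fun t : ℝ => h (a + t • v) - t * ⟪g a, v⟫ - t ^ 2 * (m / 2 * ‖v‖ ^ 2))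
      (⟪g (a + t • v), v⟫ - ⟪g a, v⟫ - t * (m * ‖v‖ ^ 2)) t := by
    refine (((hd1 t).sub ((hasDerivAt_id t).mul_const ⟪g a, v⟫)).sub
      ((hasDerivAt_pow 2 t).mul_const (m / 2 * ‖v‖ ^ 2))).congr_deriv ?_
    norm_num
    ring
  have hmono2 : MonotoneOn
      (fun t : ℝ => h (a + t • v) - t * ⟪g a, v⟫ - t ^ 2 * (m / 2 * ‖v‖ ^ 2)) (Icc 0 1) := by
    refine monotoneOn_of_hasDerivWithinAt_nonneg (convex_Icc 0 1)
      (fun t _ => (hd3 t).continuousAt.continuousWithinAt)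
      (fun t _ => (hd3 t).hasDerivWithinAt) fun t ht => ?_
    rw [interior_Icc] at ht
    have := hmono1 ht.1.le
    simp only [zero_smul, add_zero, zero_mul, sub_zero] at this
    linarith
  have h01 := hmono2 (left_mem_Icc.2 zero_le_one) (right_mem_Icc.2 zero_le_one) zero_le_one
  simp [v] at h01
  simp only [v]
  linarith

/-- A function above a paraboloid of positive curvature has bounded sublevel sets. -/
lemma isBounded_sublevel_of_paraboloid_le {h : E → ℝ} {g₀ : E} {m : ℝ} (hm : 0 < m)
    (hpar : ∀ b, h 0 + ⟪g₀, b⟫ + m / 2 * ‖b‖ ^ 2 ≤ h b) (c : ℝ) :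
    Bornology.IsBounded {θ | h θ ≤ c} := by
  refine (Metric.isBounded_closedBall (x := (0 : E))
    (r := 1 + 2 / m * (‖g₀‖ + |c - h 0|))).subset fun b hb => ?_
  rw [mem_closedBall_zero_iff]
  by_contra! hlt
  have h1 := hpar b
  have h2 : -(‖g₀‖ * ‖b‖) ≤ ⟪g₀, b⟫ := (abs_le.1 (abs_real_inner_le_norm g₀ b)).1
  have h3 : h b ≤ c := hb
  have h4 := le_abs_self (c - h 0)
  have h5 : 0 ≤ |c - h 0| := abs_nonneg _
  have hb1 : 1 < ‖b‖ := by
    have : 0 ≤ 2 / m * (‖g₀‖ + |c - h 0|) := by positivity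
    linarith
  have h6 : ‖g₀‖ + |c - h 0| < m / 2 * ‖b‖ := by
    have : m / 2 * (2 / m * (‖g₀‖ + |c - h 0|)) < m / 2 * ‖b‖ :=
      mul_lt_mul_of_pos_left (by linarith) (by positivity)
    have e : m / 2 * (2 / m * (‖g₀‖ + |c - h 0|)) = ‖g₀‖ + |c - h 0| := by field_simp
    linarith
  nlinarith [mul_lt_mul_of_pos_right h6 (zero_lt_one.trans hb1), mul_le_mul_of_nonneg_left hb1.le h5]

/-- A vector having nonpositive inner product with every strict descent direction of `g ≠ 0`
is a nonnegative multiple of `g`. -/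
lemma exists_nonneg_smul_of_inner_nonpos {g y : E} (hg : g ≠ 0)
    (hv : ∀ v, ⟪g, v⟫ < 0 → ⟪y, v⟫ ≤ 0) : ∃ c : ℝ, 0 ≤ c ∧ y = c • g := by
  have hgg : 0 < ⟪g, g⟫ := real_inner_self_pos.2 hg
  have hyg : 0 ≤ ⟪y, g⟫ := by
    have := hv (-g) (by rwa [inner_neg_right, neg_lt_zero])
    rw [inner_neg_right] at this
    linarith
  set c := ⟪y, g⟫ / ⟪g, g⟫ with hc
  have hcg : c * ⟪g, g⟫ = ⟪y, g⟫ := div_mul_cancel₀ _ hgg.ne'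
  set w := y - c • g with hw
  have hgw : ⟪g, w⟫ = 0 := by
    rw [hw, inner_sub_right, inner_smul_right, hcg, real_inner_comm, sub_self]
  have hyw : ⟪y, w⟫ = ⟪w, w⟫ := by
    have : y = w + c • g := by simp [hw]
    conv_lhs => rw [this]
    rw [inner_add_left, inner_smul_left, hgw]
    simp
  have hww : ⟪w, w⟫ ≤ 0 := by
    refine le_of_forall_pos_le_add fun ε hε => ?_
    have hδ : 0 < ε / (⟪y, g⟫ + 1) := by positivity
    have := hv (w - (ε / (⟪y, g⟫ + 1)) • g) (by
      rw [inner_sub_right, inner_smul_right, hgw]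
      nlinarith [mul_pos hδ hgg])
    rw [inner_sub_right, inner_smul_right, hyw] at this
    have e : ε / (⟪y, g⟫ + 1) * (⟪y, g⟫ + 1) = ε := div_mul_cancel₀ _ (by positivity)
    nlinarith
  refine ⟨c, by positivity, ?_⟩
  have : w = 0 := real_inner_self_nonpos.1 hww
  exact sub_eq_zero.1 this

/-- Moving along a strict descent direction of a function, one reaches smaller values. -/
lemma exists_pos_lt_of_inner_neg [CompleteSpace E] {h : E → ℝ} {g θ v : E}
    (hg : HasGradientAt h g θ) (hv : ⟪g, v⟫ < 0) : ∃ t > (0 : ℝ), h (θ + t • v) < h θ := by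
  have hd : HasDerivAt (fun t : ℝ => h (θ + t • v)) ⟪g, v⟫ 0 := by
    have hline : HasDerivAt (fun t : ℝ => θ + t • v) v 0 := by
      simpa using ((hasDerivAt_id (0 : ℝ)).smul_const v).const_add θ
    have hg' : HasFDerivAt h (InnerProductSpace.toDual ℝ E g) (θ + (0 : ℝ) • v) := by
      simpa using hg.hasFDerivAt
    simpa [Function.comp_def] using hg'.comp_hasDerivAt 0 hline
  have hslope : ∀ᶠ t in nhdsWithin (0 : ℝ) (Ioi 0), slope (fun t : ℝ => h (θ + t • v)) 0 t < 0 :=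
    (hd.tendsto_slope.mono_left
      (nhdsWithin_mono 0 (fun t ht => ne_of_gt ht))).eventually (gt_mem_nhds hv)
  obtain ⟨t, ht, ht0⟩ := (hslope.and self_mem_nhdsWithin).exists
  have ht0 : 0 < t := ht0
  refine ⟨t, ht0, ?_⟩
  rw [slope_def_field] at ht
  rw [sub_zero, div_lt_iff₀ ht0] at ht
  simpa using ht

/-- Existence of a Lagrange multiplier for maximizing a nonzero linear functional on a compact
nonempty sublevel set. -/
lemma exists_multiplier_of_isCompact_sublevel [CompleteSpace E] {h : E → ℝ} {g : E → E}
    (hg : ∀ θ, HasGradientAt h (g θ) θ) (hcomp : IsCompact {θ | h θ ≤ 0})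
    (hne : {θ | h θ ≤ 0}.Nonempty) {y : E} (hy : y ≠ 0) :
    ∃ θ : E, ∃ lam : ℝ, g θ = lam • y ∧ h θ = 0 ∧ 0 ≤ lam := by
  obtain ⟨θ, hθ, hmax⟩ := hcomp.exists_isMaxOn hne
    (continuous_const.inner continuous_id : Continuous fun θ : E => ⟪y, θ⟫).continuousOn
  have hθ : h θ ≤ 0 := hθ
  have hmax' : ∀ v : E, ∀ t > (0 : ℝ), h (θ + t • v) ≤ 0 → ⟪y, v⟫ ≤ 0 := by
    intro v t ht hv
    have : ⟪y, θ + t • v⟫ ≤ ⟪y, θ⟫ := hmax hv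
    rw [inner_add_right, inner_smul_right] at this
    by_contra! hpos
    nlinarith [mul_pos ht hpos]
  have hzero : h θ = 0 := by
    refine hθ.antisymm (not_lt.1 fun hlt => ?_)
    have hcont : ContinuousAt (fun t : ℝ => h (θ + t • y)) 0 := by
      refine ContinuousAt.comp (g := h) (hg _).continuousAt ?_
      fun_prop
    have hev : ∀ᶠ t in nhds (0 : ℝ), h (θ + t • y) < 0 :=
      hcont.eventually (gt_mem_nhds (by simpa using hlt))
    obtain ⟨t, ht, ht0⟩ := ((hev.filter_mono nhdsWithin_le_nhds).and
      (self_mem_nhdsWithin (s := Ioi (0 : ℝ)))).exists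
    exact hy (real_inner_self_nonpos.1 (hmax' y t ht0 ht.le))
  by_cases hgθ : g θ = 0
  · exact ⟨θ, 0, by simp [hgθ], hzero, le_rfl⟩
  obtain ⟨c, hc, hyc⟩ := exists_nonneg_smul_of_inner_nonpos (y := y) hgθ fun v hv => by
    obtain ⟨t, ht, hlt⟩ := exists_pos_lt_of_inner_neg (hg θ) hv
    exact hmax' v t ht (hlt.le.trans hθ)
  have hc0 : c ≠ 0 := by
    rintro rfl
    exact hy (by simpa using hyc)
  exact ⟨θ, c⁻¹, by rw [hyc, inv_smul_smul₀ hc0], hzero, inv_nonneg.2 hc⟩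

/-- A solution of the Lagrange system maximizes the linear functional on the sublevel set. -/
lemma inner_le_of_multiplier {h : E → ℝ} {g : E → E} {m : ℝ} (hm : 0 < m)
    (hpar : ∀ a b, h a + ⟪g a, b - a⟫ + m / 2 * ‖b - a‖ ^ 2 ≤ h b) {y a b : E} {lam : ℝ}
    (ha : g a = lam • y) (ha0 : h a = 0) (hlam : 0 ≤ lam) (hb : h b ≤ 0) :
    ⟪y, b⟫ ≤ ⟪y, a⟫ ∧ (⟪y, a⟫ ≤ ⟪y, b⟫ → b = a) := by
  have h1 := hpar a b
  rw [ha, ha0, real_inner_smul_left] at h1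
  have heq : ⟪y, a⟫ ≤ ⟪y, b⟫ → b = a := fun hle => by
    have h2 : 0 ≤ lam * ⟪y, b - a⟫ := mul_nonneg hlam (by rw [inner_sub_right]; linarith)
    have h3 : ‖b - a‖ ^ 2 ≤ 0 := by
      by_contra! hpos
      nlinarith [mul_pos hm hpos]
    exact sub_eq_zero.1 (norm_eq_zero.1 (pow_eq_zero_iff two_ne_zero |>.1
      (h3.antisymm (sq_nonneg _))))
  refine ⟨?_, heq⟩
  by_contra! hlt
  rw [heq hlt.le] at hlt
  exact hlt.false

end StronglyConvex

/-- for `y ≠ 0` the Lagrange-multiplier system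
`H_θ(x,θ̂) = λ y`, `H(x,θ̂) = 0`, `λ ≥ 0` has a unique solution `(θ̂,λ)`,
and for it `ℓ(x,y) = ⟨y,θ̂⟩`. -/
theorem statement4 {n : ℕ}
    (D : Set (Euc n)) (hD : IsOpen D) (hDne : D.Nonempty)
    (H : Euc n → Euc n → ℝ)
    (Hθ : Euc n → Euc n → Euc n)
    (Hθθ : Euc n → Euc n → (Euc n →L[ℝ] Euc n))
    (hHcont : ContinuousOn (fun p : Euc n × Euc n => H p.1 p.2) (D ×ˢ Set.univ))
    (hH1 : ∀ x ∈ D, H x 0 ≤ 0)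
    (hHθ : ∀ x ∈ D, ∀ θ : Euc n, HasGradientAt (H x) (Hθ x θ) θ)
    (hHθθ : ∀ x ∈ D, ∀ θ : Euc n, HasFDerivAt (Hθ x) (Hθθ x θ) θ)
    (hHθcont : ContinuousOn (fun p : Euc n × Euc n => Hθ p.1 p.2) (D ×ˢ Set.univ))
    (hHθθcont : ContinuousOn (fun p : Euc n × Euc n => Hθθ p.1 p.2) (D ×ˢ Set.univ))
    (hH3 : ∀ K ⊆ D, IsCompact K → ∃ m > (0:ℝ), ∀ x ∈ K, ∀ θ ξ : Euc n,
      m * ‖ξ‖ ^ 2 ≤ ⟪ξ, Hθθ x θ ξ⟫)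
    (ℓ : Euc n → Euc n → ℝ)
    (hℓdef : ∀ x y : Euc n, ℓ x y = sSup ((fun θ => ⟪y, θ⟫) '' {θ | H x θ ≤ 0})) :
    ∀ x ∈ D, ∀ y : Euc n, y ≠ 0 →
      (∃! p : Euc n × ℝ, Hθ x p.1 = p.2 • y ∧ H x p.1 = 0 ∧ 0 ≤ p.2) ∧
      (∀ θhat : Euc n, ∀ lam : ℝ,
        Hθ x θhat = lam • y → H x θhat = 0 → 0 ≤ lam → ℓ x y = ⟪y, θhat⟫) := by
  intro x hx y hy
  obtain ⟨m, hm, hbound⟩ := hH3 {x} (by simpa using hx) isCompact_singleton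
  have hpar : ∀ a b, H x a + ⟪Hθ x a, b - a⟫ + m / 2 * ‖b - a‖ ^ 2 ≤ H x b :=
    tangent_paraboloid_le (hHθ x hx) (hHθθ x hx) (hbound x rfl)
  have hcont : Continuous (H x) :=
    continuous_iff_continuousAt.2 fun θ => (hHθ x hx θ).continuousAt
  have hcomp : IsCompact {θ | H x θ ≤ 0} :=
    Metric.isCompact_of_isClosed_isBounded (isClosed_le hcont continuous_const)
      (isBounded_sublevel_of_paraboloid_le hm (fun b => by simpa using hpar 0 b) 0)
  refine ⟨?_, fun a lam ha ha0 hlam => ?_⟩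
  · obtain ⟨a, lam, ha, ha0, hlam⟩ :=
      exists_multiplier_of_isCompact_sublevel (hHθ x hx) hcomp ⟨0, hH1 x hx⟩ hy
    refine ⟨(a, lam), ⟨ha, ha0, hlam⟩, ?_⟩
    rintro ⟨b, mu⟩ ⟨hb, hb0, hmu⟩
    dsimp only at hb hb0 hmu
    obtain rfl : b = a := (inner_le_of_multiplier hm hpar ha ha0 hlam hb0.le).2
      (inner_le_of_multiplier hm hpar hb hb0 hmu ha0.le).1
    rw [smul_left_injective ℝ hy (hb.symm.trans ha)]
  · rw [hℓdef]
    refine IsGreatest.csSup_eq ⟨⟨a, ha0.le, rfl⟩, ?_⟩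
    rintro _ ⟨b, hb, rfl⟩
    exact (inner_le_of_multiplier hm hpar ha ha0 hlam hb).1
end

section
/- Let D ⊆ ℝⁿ be open, E ⊆ D closed in D, ℓ a local action on D, and A₁, A₂ ⊆ E closed in D. Write m := inf{S(φ) : φ : [0,1] → E absolutely continuous, φ(0) ∈ A₁, φ(1) ∈ A₂}. Suppose there is a compact set K ⊆ E and a sequence (φₙ) of absolutely continuous functions [0,1] → K with φₙ(0) ∈ A₁, φₙ(1) ∈ A₂, sup_n length(φₙ) < ∞, and S(φₙ) → m. Then there exists an absolutely continuous φ* : [0,1] → E with φ*(0) ∈ A₁, φ*(1) ∈ A₂, S(φ*) = m, and length(φ*) ≤ liminf_{n→∞} length(φₙ). -/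
open MeasureTheory Set Filter
open scoped RealInnerProductSpace

/-- `φ` is absolutely continuous on `[0,1]` with derivative `φ'`. -/
def GeoAC {n : ℕ} (φ φ' : ℝ → Euc n) : Prop :=
  MeasureTheory.IntegrableOn φ' (Set.Icc 0 1) ∧
    ∀ t ∈ Set.Icc (0:ℝ) 1, φ t = φ 0 + ∫ s in (0:ℝ)..t, φ' s

/-- The geometric action `S(φ) = ∫₀¹ ℓ(φ,φ') dα`. -/
noncomputable def geoAction {n : ℕ} (ℓ : Euc n → Euc n → ℝ) (φ φ' : ℝ → Euc n) : ℝ :=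
  ∫ α in (0:ℝ)..1, ℓ (φ α) (φ' α)

/-- The length `∫₀¹ |φ'| dα` of an absolutely continuous curve. -/
noncomputable def geoLen {n : ℕ} (φ' : ℝ → Euc n) : ℝ :=
  ∫ α in (0:ℝ)..1, ‖φ' α‖

/-- The set of actions of absolutely continuous curves in `Eset` from `A₁` to `A₂`. -/
def geoActSet {n : ℕ} (ℓ : Euc n → Euc n → ℝ) (Eset A₁ A₂ : Set (Euc n)) : Set ℝ :=
  {s | ∃ φ φ' : ℝ → Euc n, GeoAC φ φ' ∧ (∀ t ∈ Set.Icc (0:ℝ) 1, φ t ∈ Eset) ∧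
    φ 0 ∈ A₁ ∧ φ 1 ∈ A₂ ∧ s = geoAction ℓ φ φ'}

section LocalAction

variable {E : Type*} [NormedAddCommGroup E] [NormedSpace ℝ E]

/-- A local action on `D`: a nonnegative continuous integrand, positively homogeneous and convex in
its second variable. -/
structure IsLocalAction (D : Set E) (ℓ : E → E → ℝ) : Prop where
  continuousOn : ContinuousOn (fun p : E × E => ℓ p.1 p.2) (D ×ˢ univ)
  nonneg : ∀ x ∈ D, ∀ y, 0 ≤ ℓ x y
  map_smul : ∀ x ∈ D, ∀ y, ∀ c : ℝ, 0 ≤ c → ℓ x (c • y) = c * ℓ x y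
  convexOn : ∀ x ∈ D, ConvexOn ℝ univ (ℓ x)

theorem isLocalAction_norm (D : Set E) : IsLocalAction D fun _ y => ‖y‖ where
  continuousOn := by fun_prop
  nonneg _ _ y := norm_nonneg y
  map_smul _ _ y c hc := by rw [norm_smul, Real.norm_of_nonneg hc]
  convexOn _ _ := convexOn_univ_norm

namespace IsLocalAction

variable {D K : Set E} {ℓ : E → E → ℝ}

theorem map_zero (h : IsLocalAction D ℓ) {x : E} (hx : x ∈ D) : ℓ x 0 = 0 := by
  simpa using h.map_smul x hx 0 0 le_rfl

theorem continuous_right (h : IsLocalAction D ℓ) {x : E} (hx : x ∈ D) : Continuous (ℓ x) := by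
  rw [← continuousOn_univ]
  exact h.continuousOn.comp (f := fun y => (x, y)) (by fun_prop) fun y _ => ⟨hx, mem_univ y⟩

theorem tendsto (h : IsLocalAction D ℓ) (hD : IsOpen D) {ι : Type*} {F : Filter ι} {u v : ι → E}
    {x y : E} (hx : x ∈ D) (hu : Tendsto u F (nhds x)) (hv : Tendsto v F (nhds y)) :
    Tendsto (fun i => ℓ (u i) (v i)) F (nhds (ℓ x y)) := by
  have hc : ContinuousAt (fun p : E × E => ℓ p.1 p.2) (x, y) :=
    h.continuousOn.continuousAt ((hD.prod isOpen_univ).mem_nhds ⟨hx, mem_univ y⟩)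
  exact hc.tendsto.comp (hu.prodMk_nhds hv)

theorem aestronglyMeasurable_comp [FiniteDimensional ℝ E] [MeasurableSpace E] [BorelSpace E]
    (h : IsLocalAction D ℓ) (hD : IsOpen D) {α : Type*} [MeasurableSpace α] {μ : Measure α}
    {u v : α → E} (hu : AEMeasurable u μ) (hv : AEMeasurable v μ) (huD : ∀ᵐ a ∂μ, u a ∈ D) :
    AEStronglyMeasurable (fun a => ℓ (u a) (v a)) μ := by
  classical
  have := FiniteDimensional.proper ℝ E
  have hm : Measurable ((D ×ˢ univ).piecewise (fun p : E × E => ℓ p.1 p.2) 0) :=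
    h.continuousOn.measurable_piecewise continuousOn_const (hD.prod isOpen_univ).measurableSet
  refine (hm.comp_aemeasurable (hu.prodMk hv)).aestronglyMeasurable.congr ?_
  filter_upwards [huD] with a ha
  simp [ha]

theorem exists_bound [FiniteDimensional ℝ E] (h : IsLocalAction D ℓ) (hK : IsCompact K)
    (hKD : K ⊆ D) : ∃ C, 0 ≤ C ∧ ∀ x ∈ K, ∀ y, ℓ x y ≤ C * ‖y‖ := by
  have := FiniteDimensional.proper ℝ E
  obtain ⟨C, hC⟩ := (hK.prod (isCompact_closedBall (0 : E) 1)).exists_bound_of_continuousOn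
    (h.continuousOn.mono (prod_mono hKD (subset_univ _)))
  refine ⟨max C 0, le_max_right _ _, fun x hx y => ?_⟩
  have hy : ℓ x y = ‖y‖ * ℓ x (‖y‖⁻¹ • y) := by
    rw [← h.map_smul x (hKD hx) _ _ (norm_nonneg y)]
    rcases eq_or_ne y 0 with rfl | hy
    · simp
    · rw [smul_inv_smul₀ (norm_ne_zero_iff.2 hy)]
  have hb := (le_abs_self _).trans (hC (x, ‖y‖⁻¹ • y)
    ⟨hx, by simpa [norm_smul] using inv_mul_le_one⟩)
  rw [hy, mul_comm]
  exact mul_le_mul_of_nonneg_right (hb.trans (le_max_left _ _)) (norm_nonneg y)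

theorem exists_modulus [FiniteDimensional ℝ E] (h : IsLocalAction D ℓ) (hK : IsCompact K)
    (hKD : K ⊆ D) {η : ℝ} (hη : 0 < η) :
    ∃ δ > 0, ∀ x ∈ K, ∀ x' ∈ K, dist x x' < δ → ∀ y, |ℓ x y - ℓ x' y| ≤ η * ‖y‖ := by
  have := FiniteDimensional.proper ℝ E
  have huc := (hK.prod (isCompact_closedBall (0 : E) 1)).uniformContinuousOn_of_continuous
    (h.continuousOn.mono (prod_mono hKD (subset_univ _)))
  obtain ⟨δ, hδ, hd⟩ := Metric.uniformContinuousOn_iff.1 huc η hη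
  refine ⟨δ, hδ, fun x hx x' hx' hxx y => ?_⟩
  have hb : ‖‖y‖⁻¹ • y‖ ≤ 1 := by simpa [norm_smul] using inv_mul_le_one
  have key := hd (x, ‖y‖⁻¹ • y) ⟨hx, by simpa using hb⟩ (x', ‖y‖⁻¹ • y) ⟨hx', by simpa using hb⟩
    (by simpa [Prod.dist_eq, hδ] using hxx)
  have hy : ∀ z ∈ K, ℓ z y = ‖y‖ * ℓ z (‖y‖⁻¹ • y) := fun z hz => by
    rw [← h.map_smul z (hKD hz) _ _ (norm_nonneg y)]
    rcases eq_or_ne y 0 with rfl | hy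
    · simp
    · rw [smul_inv_smul₀ (norm_ne_zero_iff.2 hy)]
  rw [hy x hx, hy x' hx', ← mul_sub, abs_mul, abs_norm, mul_comm]
  exact mul_le_mul_of_nonneg_right key.le (norm_nonneg y)

theorem integrable_comp [FiniteDimensional ℝ E] [MeasurableSpace E] [BorelSpace E]
    (h : IsLocalAction D ℓ) (hD : IsOpen D) (hK : IsCompact K) (hKD : K ⊆ D) {α : Type*}
    [MeasurableSpace α] {μ : Measure α} {u v : α → E} (hu : AEMeasurable u μ)
    (hv : Integrable v μ) (huK : ∀ᵐ a ∂μ, u a ∈ K) :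
    Integrable (fun a => ℓ (u a) (v a)) μ := by
  obtain ⟨C, hC0, hC⟩ := h.exists_bound hK hKD
  refine (hv.norm.const_mul C).mono' (h.aestronglyMeasurable_comp hD hu
    hv.aestronglyMeasurable.aemeasurable (huK.mono fun a ha => hKD ha)) ?_
  filter_upwards [huK] with a ha
  rw [Real.norm_of_nonneg (h.nonneg _ (hKD ha) _)]
  exact hC _ ha _

/-- Jensen's inequality for a local action with frozen base point. -/
theorem map_integral_le [FiniteDimensional ℝ E] (h : IsLocalAction D ℓ)
    {x : E} (hx : x ∈ D) {a b : ℝ} (hab : a ≤ b) {f : ℝ → E}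
    (hf : IntervalIntegrable f volume a b)
    (hℓf : IntervalIntegrable (fun s => ℓ x (f s)) volume a b) :
    ℓ x (∫ s in a..b, f s) ≤ ∫ s in a..b, ℓ x (f s) := by
  rcases hab.eq_or_lt with rfl | hab'
  · simp [h.map_zero hx]
  rw [intervalIntegrable_iff_integrableOn_Ioc_of_le hab] at hf hℓf
  have hJ := (h.convexOn x hx).map_set_average_le (h.continuous_right hx).continuousOn
    isClosed_univ (μ := volume) (t := Ioc a b) (f := f) (by simpa using hab') (by simp)
    (by simp) hf hℓf
  have hba : 0 < b - a := sub_pos.2 hab'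
  rw [setAverage_eq, setAverage_eq, Real.volume_real_Ioc_of_le hab,
    h.map_smul x hx _ _ (inv_nonneg.2 hba.le), smul_eq_mul] at hJ
  rw [intervalIntegral.integral_of_le hab, intervalIntegral.integral_of_le hab]
  exact le_of_mul_le_mul_left hJ (inv_pos.2 hba)

end IsLocalAction

end LocalAction

section Curves

variable {E : Type*} [NormedAddCommGroup E] [NormedSpace ℝ E]

/-- Difference quotients over shrinking intervals containing a point of differentiability converge
to the derivative. -/
theorem HasDerivAt.tendsto_straddling_slope {f : ℝ → E} {f' : E} {t : ℝ} (hf : HasDerivAt f f' t)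
    {ι : Type*} {F : Filter ι} {a b : ι → ℝ} (ha : Tendsto a F (nhds t))
    (hb : Tendsto b F (nhds t)) (hat : ∀ᶠ i in F, a i ≤ t) (htb : ∀ᶠ i in F, t ≤ b i)
    (hab : ∀ᶠ i in F, a i < b i) :
    Tendsto (fun i => (b i - a i)⁻¹ • (f (b i) - f (a i))) F (nhds f') := by
  rw [Metric.tendsto_nhds]
  intro ε hε
  have hloc : ∀ᶠ x in nhds t, ‖f x - f t - (x - t) • f'‖ ≤ ε / 2 * ‖x - t‖ :=
    (hasDerivAt_iff_isLittleO.1 hf).def (half_pos hε)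
  filter_upwards [ha.eventually hloc, hb.eventually hloc, hat, htb, hab] with i hai hbi h1 h2 h3
  have h4 : 0 < b i - a i := sub_pos.2 h3
  have hsplit : (b i - a i)⁻¹ • (f (b i) - f (a i)) - f' = (b i - a i)⁻¹ •
      ((f (b i) - f t - (b i - t) • f') - (f (a i) - f t - (a i - t) • f')) := by
    rw [eq_inv_smul_iff₀ h4.ne', smul_sub, smul_inv_smul₀ h4.ne']
    module
  rw [dist_eq_norm, hsplit, norm_smul, norm_inv, Real.norm_of_nonneg h4.le, inv_mul_lt_iff₀ h4]
  rw [Real.norm_of_nonneg (sub_nonneg.2 h2)] at hbi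
  rw [Real.norm_of_nonpos (sub_nonpos.2 h1)] at hai
  have := norm_sub_le (f (b i) - f t - (b i - t) • f') (f (a i) - f t - (a i - t) • f')
  nlinarith

theorem LipschitzWith.intervalIntegrable_deriv [FiniteDimensional ℝ E] {f : ℝ → E} {M : NNReal}
    (hf : LipschitzWith M f) (a b : ℝ) : IntervalIntegrable (deriv f) volume a b := by
  borelize E
  have := FiniteDimensional.complete ℝ E
  refine (intervalIntegrable_const (c := (M : ℝ))).mono_fun
    (stronglyMeasurable_deriv f).aestronglyMeasurable (ae_of_all _ fun t => ?_)
  simpa using norm_deriv_le_of_lipschitz hf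

theorem LipschitzWith.integral_deriv_eq_sub [FiniteDimensional ℝ E] {f : ℝ → E} {M : NNReal}
    (hf : LipschitzWith M f) (a b : ℝ) : ∫ t in a..b, deriv f t = f b - f a := by
  have := FiniteDimensional.complete ℝ E
  refine (SeparatingDual.eq_iff_forall_dual_eq (R := ℝ)).2 fun g => ?_
  have hgf : LipschitzWith (‖g‖₊ * M) (fun t => g (f t)) := g.lipschitz.comp hf
  have hg := (hgf.lipschitzOnWith (s := uIcc a b)).absolutelyContinuousOnInterval
    |>.integral_deriv_eq_sub
  rw [← g.intervalIntegral_comp_comm (hf.intervalIntegrable_deriv a b), map_sub, ← hg]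
  refine intervalIntegral.integral_congr_ae ?_
  filter_upwards [hf.ae_differentiableAt_real] with t ht _
  exact (g.hasFDerivAt.comp_hasDerivAt t ht.hasDerivAt).deriv.symm

end Curves

section Geometric

variable {n : ℕ}

theorem GeoAC.intervalIntegrable {u v : ℝ → Euc n} (h : GeoAC u v) {a b : ℝ}
    (ha : a ∈ Icc (0 : ℝ) 1) (hb : b ∈ Icc (0 : ℝ) 1) : IntervalIntegrable v volume a b :=
  (h.1.mono_set (ordConnected_Icc.uIcc_subset ha hb) : IntegrableOn v (uIcc a b)).intervalIntegrable

theorem GeoAC.sub_eq_integral {u v : ℝ → Euc n} (h : GeoAC u v) {a b : ℝ}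
    (ha : a ∈ Icc (0 : ℝ) 1) (hb : b ∈ Icc (0 : ℝ) 1) : u b - u a = ∫ s in a..b, v s := by
  have h0 : (0 : ℝ) ∈ Icc (0 : ℝ) 1 := by simp
  rw [h.2 b hb, h.2 a ha, add_sub_add_left_eq_sub, intervalIntegral.integral_interval_sub_left
    (h.intervalIntegrable h0 hb) (h.intervalIntegrable h0 ha)]

theorem GeoAC.continuousOn {u v : ℝ → Euc n} (h : GeoAC u v) : ContinuousOn u (Icc 0 1) := by
  have hc : ContinuousOn (fun t => u 0 + ∫ s in (0 : ℝ)..t, v s) (Icc 0 1) := by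
    have := intervalIntegral.continuousOn_primitive_interval (μ := volume) (f := v) (a := 0)
      (b := 1) (by rw [uIcc_of_le zero_le_one]; exact h.1)
    rw [uIcc_of_le zero_le_one] at this
    exact continuousOn_const.add this
  exact hc.congr h.2

theorem LipschitzWith.geoAC {f : ℝ → Euc n} {M : NNReal} (hf : LipschitzWith M f) :
    GeoAC f (deriv f) := by
  refine ⟨?_, fun t _ => by rw [hf.integral_deriv_eq_sub]; abel⟩
  rw [integrableOn_Icc_iff_integrableOn_Ioc,
    ← intervalIntegrable_iff_integrableOn_Ioc_of_le zero_le_one]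
  exact hf.intervalIntegrable_deriv 0 1

theorem GeoAC.integrableOn_action {D K : Set (Euc n)} {ℓ : Euc n → Euc n → ℝ}
    (hℓ : IsLocalAction D ℓ) (hD : IsOpen D) (hK : IsCompact K) (hKD : K ⊆ D) {u v : ℝ → Euc n}
    (h : GeoAC u v) (huK : ∀ t ∈ Icc (0 : ℝ) 1, u t ∈ K) :
    IntegrableOn (fun t => ℓ (u t) (v t)) (Icc 0 1) :=
  hℓ.integrable_comp hD hK hKD (h.continuousOn.aemeasurable measurableSet_Icc) h.1
    (ae_restrict_of_forall_mem measurableSet_Icc huK)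

theorem GeoAC.sum_le_geoAction_add {D K : Set (Euc n)} {ℓ : Euc n → Euc n → ℝ}
    (hℓ : IsLocalAction D ℓ) (hD : IsOpen D) (hK : IsCompact K) (hKD : K ⊆ D) {u v : ℝ → Euc n}
    (h : GeoAC u v) (huK : ∀ t ∈ Icc (0 : ℝ) 1, u t ∈ K) {η δ : ℝ}
    (hmod : ∀ x ∈ K, ∀ x' ∈ K, dist x x' < δ → ∀ y, |ℓ x y - ℓ x' y| ≤ η * ‖y‖)
    {N : ℕ} {a : ℕ → ℝ} (ha0 : a 0 = 0) (haN : a N = 1) (hmem : ∀ i ≤ N, a i ∈ Icc (0 : ℝ) 1)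
    (hstep : ∀ i < N, a i ≤ a (i + 1))
    (hosc : ∀ i < N, ∀ s ∈ Icc (a i) (a (i + 1)), dist (u (a i)) (u s) < δ) :
    ∑ i ∈ Finset.range N, ℓ (u (a i)) (u (a (i + 1)) - u (a i)) ≤
      geoAction ℓ u v + η * geoLen v := by
  have hsub : ∀ {g : ℝ → ℝ}, IntegrableOn g (Icc 0 1) → ∀ i < N,
      IntervalIntegrable g volume (a i) (a (i + 1)) := fun hg i hi =>
    (hg.mono_set (ordConnected_Icc.uIcc_subset (hmem i hi.le) (hmem (i + 1) hi))
      : IntegrableOn _ (uIcc (a i) (a (i + 1)))).intervalIntegrable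
  have hact := GeoAC.integrableOn_action hℓ hD hK hKD h huK
  have hboth : IntegrableOn (fun s => ℓ (u s) (v s) + η * ‖v s‖) (Icc 0 1) :=
    hact.add (h.1.norm.const_mul η)
  have hsum : geoAction ℓ u v + η * geoLen v =
      ∑ i ∈ Finset.range N, ∫ s in (a i)..(a (i + 1)), (ℓ (u s) (v s) + η * ‖v s‖) := by
    rw [intervalIntegral.sum_integral_adjacent_intervals (hsub hboth), ha0, haN,
      intervalIntegral.integral_add,
      intervalIntegral.integral_const_mul]
    · rfl
    · exact (hact.mono_set (by rw [uIcc_of_le zero_le_one])).intervalIntegrable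
    · exact (h.intervalIntegrable (by simp) (by simp)).norm.const_mul η
  rw [hsum]
  refine Finset.sum_le_sum fun i hi => ?_
  have hi := Finset.mem_range.1 hi
  have hx := huK _ (hmem i hi.le)
  have hfrozen : IntegrableOn (fun s => ℓ (u (a i)) (v s)) (Icc 0 1) :=
    hℓ.integrable_comp hD hK hKD aemeasurable_const h.1 (ae_of_all _ fun _ => hx)
  rw [h.sub_eq_integral (hmem i hi.le) (hmem (i + 1) hi)]
  refine (hℓ.map_integral_le (hKD hx) (hstep i hi)
    (h.intervalIntegrable (hmem i hi.le) (hmem (i + 1) hi)) (hsub hfrozen i hi)).trans ?_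
  refine intervalIntegral.integral_mono_on (hstep i hi) (hsub hfrozen i hi)
    (hsub hboth i hi) fun s hs => ?_
  have hs1 : s ∈ Icc (0 : ℝ) 1 :=
    ⟨(hmem i hi.le).1.trans hs.1, hs.2.trans (hmem (i + 1) hi).2⟩
  have := (abs_le.1 (hmod _ hx _ (huK s hs1) (hosc i hi s hs) (v s))).2
  linarith

/-- A curve of length at most `L` can be traversed with speed at most `L + 1`. -/
theorem GeoAC.exists_reparametrization {u v : ℝ → Euc n} (h : GeoAC u v) {L : ℝ}
    (hL : geoLen v ≤ L) :
    ∃ τ : ℝ → ℝ, τ 0 = 0 ∧ τ 1 = 1 ∧ (∀ t ∈ Icc (0 : ℝ) 1, τ t ∈ Icc (0 : ℝ) 1) ∧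
      MonotoneOn τ (Icc 0 1) ∧ ∀ t₁ ∈ Icc (0 : ℝ) 1, ∀ t₂ ∈ Icc (0 : ℝ) 1,
        ∀ s ∈ Icc (τ t₁) (τ t₂), dist (u (τ t₁)) (u s) ≤ (L + 1) * (t₂ - t₁) := by
  have h0 : (0 : ℝ) ∈ Icc (0 : ℝ) 1 := by simp
  have h1 : (1 : ℝ) ∈ Icc (0 : ℝ) 1 := by simp
  have hlen : 0 ≤ geoLen v :=
    intervalIntegral.integral_nonneg zero_le_one fun _ _ => norm_nonneg _
  have hg_int : ∀ {a b : ℝ}, a ∈ Icc (0 : ℝ) 1 → b ∈ Icc (0 : ℝ) 1 →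
      IntervalIntegrable (fun s => ‖v s‖ + 1) volume a b := fun ha hb =>
    (h.intervalIntegrable ha hb).norm.add intervalIntegrable_const
  set Λ := geoLen v + 1 with hΛ
  have hΛ0 : 0 < Λ := by positivity
  set σ : ℝ → ℝ := fun t => (∫ s in (0 : ℝ)..t, (‖v s‖ + 1)) / Λ with hσ
  have hσ0 : σ 0 = 0 := by simp [hσ]
  have hσ1 : σ 1 = 1 := by
    have : (∫ s in (0 : ℝ)..1, (‖v s‖ + 1)) = Λ := by
      rw [intervalIntegral.integral_add (h.intervalIntegrable h0 h1).norm intervalIntegrable_const]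
      simp [hΛ, geoLen]
    simp only [hσ, this, div_self hΛ0.ne']
  have hσc : ContinuousOn σ (Icc 0 1) := by
    have := intervalIntegral.continuousOn_primitive_interval (μ := volume)
      (f := fun s => ‖v s‖ + 1) (a := 0) (b := 1)
      (by rw [uIcc_of_le zero_le_one]; exact h.1.norm.add (integrableOn_const (by simp)))
    rw [uIcc_of_le zero_le_one] at this
    exact this.div_const Λ
  have hσd : ∀ a ∈ Icc (0 : ℝ) 1, ∀ b ∈ Icc (0 : ℝ) 1, a ≤ b →
      dist (u a) (u b) + (b - a) ≤ Λ * (σ b - σ a) := by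
    intro a ha b hb hab
    have e : Λ * (σ b - σ a) = ∫ s in a..b, (‖v s‖ + 1) := by
      rw [← intervalIntegral.integral_interval_sub_left (hg_int h0 hb) (hg_int h0 ha)]
      simp only [hσ]
      field_simp
    rw [e, intervalIntegral.integral_add (h.intervalIntegrable ha hb).norm
      intervalIntegrable_const, dist_comm, dist_eq_norm, h.sub_eq_integral ha hb]
    have := intervalIntegral.norm_integral_le_integral_norm (f := v) (μ := volume) hab
    simpa using this
  have hsurj : ∀ t ∈ Icc (0 : ℝ) 1, ∃ s ∈ Icc (0 : ℝ) 1, σ s = t := by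
    have := intermediate_value_Icc zero_le_one hσc
    rwa [hσ0, hσ1] at this
  choose! τ hτ hστ using hsurj
  have hmono : ∀ a ∈ Icc (0 : ℝ) 1, ∀ b ∈ Icc (0 : ℝ) 1, a ≤ b → σ a ≤ σ b := by
    intro a ha b hb hab
    have := hσd a ha b hb hab
    have : 0 ≤ Λ * (σ b - σ a) := le_trans (add_nonneg dist_nonneg (sub_nonneg.2 hab)) this
    linarith [nonneg_of_mul_nonneg_right this hΛ0]
  have hinj : ∀ a ∈ Icc (0 : ℝ) 1, ∀ b ∈ Icc (0 : ℝ) 1, σ b ≤ σ a → b ≤ a := by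
    intro a ha b hb hs
    by_contra! hab
    have := hσd a ha b hb hab.le
    nlinarith [dist_nonneg (x := u a) (y := u b)]
  refine ⟨τ, ?_, ?_, hτ, fun t₁ ht₁ t₂ ht₂ h12 => ?_, fun t₁ ht₁ t₂ ht₂ s hs => ?_⟩
  · exact le_antisymm (hinj _ h0 _ (hτ 0 h0) (by rw [hστ 0 h0, hσ0])) (hτ 0 h0).1
  · exact le_antisymm (hτ 1 h1).2 (hinj _ (hτ 1 h1) _ h1 (by rw [hστ 1 h1, hσ1]))
  · exact hinj _ (hτ t₂ ht₂) _ (hτ t₁ ht₁) (by rwa [hστ t₁ ht₁, hστ t₂ ht₂])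
  · have hs1 : s ∈ Icc (0 : ℝ) 1 := ⟨(hτ t₁ ht₁).1.trans hs.1, hs.2.trans (hτ t₂ ht₂).2⟩
    have hA := hσd _ (hτ t₁ ht₁) s hs1 hs.1
    have hB := hmono s hs1 _ (hτ t₂ ht₂) hs.2
    have hC := hmono _ (hτ t₁ ht₁) s hs1 hs.1
    rw [hστ t₁ ht₁] at hA hC
    rw [hστ t₂ ht₂] at hB
    have hD : Λ * (σ s - t₁) ≤ (L + 1) * (t₂ - t₁) :=
      mul_le_mul (by linarith) (by linarith) (by linarith) (by linarith)
    linarith [hs.1]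

theorem LipschitzWith.tendsto_sum_geoAction {D K : Set (Euc n)} {ℓ : Euc n → Euc n → ℝ}
    (hℓ : IsLocalAction D ℓ) (hD : IsOpen D) (hK : IsCompact K) (hKD : K ⊆ D) {f : ℝ → Euc n}
    {M : NNReal} (hf : LipschitzWith M f) (hfK : ∀ t ∈ Icc (0 : ℝ) 1, f t ∈ K) :
    Tendsto (fun N : ℕ => ∑ i ∈ Finset.range N,
        ℓ (f (i / N)) (f (((i + 1 : ℕ) : ℝ) / N) - f (i / N))) atTop
      (nhds (geoAction ℓ f (deriv f))) := by
  set a : ℕ → ℝ → ℝ := fun N t => (⌊N * t⌋₊ : ℝ) / N with ha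
  set b : ℕ → ℝ → ℝ := fun N t => ((⌊N * t⌋₊ + 1 : ℕ) : ℝ) / N with hb
  set q : ℕ → ℝ → Euc n := fun N t => (N : ℝ) • (f (b N t) - f (a N t)) with hq
  have hab : ∀ N t, b N t - a N t = (N : ℝ)⁻¹ := fun N t => by
    simp only [ha, hb]; push_cast; ring
  have hat : ∀ (N : ℕ) (t : ℝ), 0 ≤ t → a N t ≤ t := fun N t ht => by
    rcases N.eq_zero_or_pos with rfl | hN
    · simpa [ha] using ht
    · have hN' : (0 : ℝ) < N := by exact_mod_cast hN
      rw [div_le_iff₀ hN', mul_comm t]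
      exact Nat.floor_le (by positivity)
  have htb : ∀ (N : ℕ) (t : ℝ), 0 < N → t ≤ b N t := fun N t hN => by
    have hN' : (0 : ℝ) < N := by exact_mod_cast hN
    rw [le_div_iff₀ hN', mul_comm t]
    exact_mod_cast (Nat.lt_floor_add_one _).le
  have haK : ∀ N, ∀ t ∈ Icc (0 : ℝ) 1, f (a N t) ∈ K := fun N t ht =>
    hfK _ ⟨by positivity, (hat N t ht.1).trans ht.2⟩
  have hqM : ∀ N t, ‖q N t‖ ≤ M := fun N t => by
    have := hf.dist_le_mul (b N t) (a N t)
    rw [dist_eq_norm, Real.dist_eq, hab, abs_of_nonneg (by positivity)] at this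
    rw [hq, norm_smul, Real.norm_of_nonneg (by positivity)]
    calc (N : ℝ) * ‖f (b N t) - f (a N t)‖ ≤ N * (M * (N : ℝ)⁻¹) := by gcongr
      _ = M * (N * (N : ℝ)⁻¹) := by ring
      _ ≤ M * 1 := by gcongr; exact mul_inv_le_one
      _ = M := mul_one _
  have hfloor : ∀ N : ℕ, Measurable fun t : ℝ => ⌊N * t⌋₊ := fun N =>
    Nat.measurable_floor.comp (measurable_const_mul _)
  have ham : ∀ N, Measurable fun t => f (a N t) := fun N =>
    hf.continuous.measurable.comp
      ((measurable_from_top (f := fun k : ℕ => (k : ℝ) / N)).comp (hfloor N))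
  have hbm : ∀ N, Measurable fun t => f (b N t) := fun N =>
    hf.continuous.measurable.comp
      ((measurable_from_top (f := fun k : ℕ => ((k + 1 : ℕ) : ℝ) / N)).comp (hfloor N))
  have hqm : ∀ N, Measurable (q N) := fun N =>
    (((hbm N).sub (ham N)).const_smul (N : ℝ) :)
  have hg_int : ∀ N, IntegrableOn (fun t => ℓ (f (a N t)) (q N t)) (Icc 0 1) := fun N =>
    hℓ.integrable_comp hD hK hKD (ham N).aemeasurable
      (Integrable.of_bound (hqm N).aestronglyMeasurable M (ae_of_all _ (hqM N)))
      (ae_restrict_of_forall_mem measurableSet_Icc (haK N))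
  have hsum : ∀ N : ℕ, 0 < N → ∫ t in (0 : ℝ)..1, ℓ (f (a N t)) (q N t) =
      ∑ i ∈ Finset.range N, ℓ (f (i / N)) (f (((i + 1 : ℕ) : ℝ) / N) - f (i / N)) := by
    intro N hN
    have hN' : (0 : ℝ) < N := by exact_mod_cast hN
    have hmem : ∀ i ≤ N, (i : ℝ) / N ∈ Icc (0 : ℝ) 1 := fun i hi =>
      ⟨by positivity, (div_le_one hN').2 (by exact_mod_cast hi)⟩
    have hadd := intervalIntegral.sum_integral_adjacent_intervals (μ := volume)
      (f := fun t => ℓ (f (a N t)) (q N t)) (a := fun i : ℕ => (i : ℝ) / N) (n := N)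
      (fun i hi => ((hg_int N).mono_set
        (ordConnected_Icc.uIcc_subset (hmem i hi.le) (hmem (i + 1) hi))).intervalIntegrable)
    simp only [Nat.cast_zero, zero_div, div_self hN'.ne'] at hadd
    rw [← hadd]
    refine Finset.sum_congr rfl fun i hi => ?_
    have hle : (i : ℝ) / N ≤ ((i + 1 : ℕ) : ℝ) / N := by gcongr; simp
    have hconst : EqOn (fun t => ℓ (f (a N t)) (q N t))
        (fun _ => N * ℓ (f (i / N)) (f (((i + 1 : ℕ) : ℝ) / N) - f (i / N)))
        (Ioo ((i : ℝ) / N) (((i + 1 : ℕ) : ℝ) / N)) := by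
      intro t ht
      have hfl : ⌊N * t⌋₊ = i := by
        have h1 := (div_lt_iff₀ hN').1 ht.1
        have h2 := (lt_div_iff₀ hN').1 ht.2
        rw [Nat.floor_eq_iff (by nlinarith [(Nat.cast_nonneg i : (0 : ℝ) ≤ i)])]
        push_cast at h2
        constructor <;> linarith
      simp only [ha, hb, hq, hfl]
      exact hℓ.map_smul _ (hKD (hfK _ (hmem i (Finset.mem_range.1 hi).le))) _ _ hN'.le
    rw [intervalIntegral.integral_congr_Ioo_of_le hle hconst, intervalIntegral.integral_const,
      smul_eq_mul]
    push_cast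
    field_simp
    ring
  have hlim : Tendsto (fun N : ℕ => ∫ t in (0 : ℝ)..1, ℓ (f (a N t)) (q N t)) atTop
      (nhds (geoAction ℓ f (deriv f))) := by
    obtain ⟨C, hC0, hC⟩ := hℓ.exists_bound hK hKD
    simp only [geoAction, intervalIntegral.integral_of_le zero_le_one,
      ← integral_Icc_eq_integral_Ioc]
    refine tendsto_integral_of_dominated_convergence (fun _ => C * M)
      (fun N => (hg_int N).aestronglyMeasurable) (integrable_const _)
      (fun N => ae_restrict_of_forall_mem measurableSet_Icc fun t ht => ?_) ?_
    · rw [Real.norm_of_nonneg (hℓ.nonneg _ (hKD (haK N t ht)) _)]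
      exact (hC _ (haK N t ht) _).trans (mul_le_mul_of_nonneg_left (hqM N t) hC0)
    · rw [ae_restrict_iff' measurableSet_Icc]
      filter_upwards [hf.ae_differentiableAt_real] with t hdt ht
      have hev : ∀ᶠ N : ℕ in atTop, 0 < N := eventually_gt_atTop 0
      have hta : Tendsto (fun N => a N t) atTop (nhds t) := by
        have := (tendsto_nat_floor_mul_div_atTop ht.1).comp (tendsto_natCast_atTop_atTop (R := ℝ))
        simpa [Function.comp_def, ha, mul_comm] using this
      have htb' : Tendsto (fun N => b N t) atTop (nhds t) := by
        have : Tendsto (fun N => a N t + (N : ℝ)⁻¹) atTop (nhds (t + 0)) :=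
          hta.add tendsto_inv_atTop_nhds_zero_nat
        rw [add_zero] at this
        exact this.congr fun N => by rw [← hab N t]; ring
      refine hℓ.tendsto hD (hKD (hfK t ht)) ((hf.continuous.tendsto t).comp hta) ?_
      refine (hdt.hasDerivAt.tendsto_straddling_slope hta htb' (.of_forall fun N => hat N t ht.1)
        (hev.mono fun N hN => htb N t hN) (hev.mono fun N hN => ?_)).congr fun N => ?_
      · have := hab N t
        have hN' : (0 : ℝ) < (N : ℝ)⁻¹ := by positivity
        linarith
      · rw [hab, inv_inv]
  exact hlim.congr' ((eventually_gt_atTop 0).mono hsum)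

/-- Lower semicontinuity of the geometric action under pointwise convergence of suitable
reparametrizations. -/
theorem LipschitzWith.geoAction_deriv_le {D K : Set (Euc n)} {ℓ : Euc n → Euc n → ℝ}
    (hℓ : IsLocalAction D ℓ) (hD : IsOpen D) (hK : IsCompact K) (hKD : K ⊆ D) {f : ℝ → Euc n}
    {M : NNReal} (hf : LipschitzWith M f) (hfK : ∀ t ∈ Icc (0 : ℝ) 1, f t ∈ K)
    {u v : ℕ → ℝ → Euc n} (hAC : ∀ k, GeoAC (u k) (v k))
    (huK : ∀ k, ∀ t ∈ Icc (0 : ℝ) 1, u k t ∈ K) {L : ℝ} (hL : ∀ k, geoLen (v k) ≤ L)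
    {τ : ℕ → ℝ → ℝ} (hτ0 : ∀ k, τ k 0 = 0) (hτ1 : ∀ k, τ k 1 = 1)
    (hτ : ∀ k, ∀ t ∈ Icc (0 : ℝ) 1, τ k t ∈ Icc (0 : ℝ) 1)
    (hτm : ∀ k, MonotoneOn (τ k) (Icc 0 1)) {R : ℝ}
    (hosc : ∀ k, ∀ t₁ ∈ Icc (0 : ℝ) 1, ∀ t₂ ∈ Icc (0 : ℝ) 1, ∀ s ∈ Icc (τ k t₁) (τ k t₂),
      dist (u k (τ k t₁)) (u k s) ≤ R * (t₂ - t₁))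
    (hlim : ∀ t ∈ Icc (0 : ℝ) 1, Tendsto (fun k => u k (τ k t)) atTop (nhds (f t)))
    {S : ℝ} (hS : Tendsto (fun k => geoAction ℓ (u k) (v k)) atTop (nhds S)) :
    geoAction ℓ f (deriv f) ≤ S := by
  have hη : ∀ η : ℝ, 0 < η → geoAction ℓ f (deriv f) ≤ S + η * L := by
    intro η hη
    obtain ⟨δ, hδ, hmod⟩ := hℓ.exists_modulus hK hKD hη
    refine le_of_tendsto (hf.tendsto_sum_geoAction hℓ hD hK hKD hfK) ?_
    have hsmall : ∀ᶠ N : ℕ in atTop, R * (N : ℝ)⁻¹ < δ := by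
      have := (tendsto_inv_atTop_nhds_zero_nat (𝕜 := ℝ)).const_mul R
      rw [mul_zero] at this
      exact this.eventually_lt_const hδ
    filter_upwards [hsmall, eventually_gt_atTop 0] with N hNδ hN
    have hN' : (0 : ℝ) < N := by exact_mod_cast hN
    have hmem : ∀ i ≤ N, (i : ℝ) / N ∈ Icc (0 : ℝ) 1 := fun i hi =>
      ⟨by positivity, (div_le_one hN').2 (by exact_mod_cast hi)⟩
    have hstep : ∀ i : ℕ, (i : ℝ) / N ≤ ((i + 1 : ℕ) : ℝ) / N := fun i => by gcongr; simp
    refine le_of_tendsto_of_tendsto (tendsto_finsetSum _ fun i hi => ?_)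
      (hS.add_const (η * L)) (.of_forall fun k => ?_)
      (f := fun k => ∑ i ∈ Finset.range N, ℓ (u k (τ k (i / N)))
        (u k (τ k (((i + 1 : ℕ) : ℝ) / N)) - u k (τ k (i / N))))
    · have hi := Finset.mem_range.1 hi
      have h1 := hlim _ (hmem i hi.le)
      exact hℓ.tendsto hD (hKD (hfK _ (hmem i hi.le))) h1 ((hlim _ (hmem (i + 1) hi)).sub h1)
    · have key := (hAC k).sum_le_geoAction_add hℓ hD hK hKD (huK k) hmod (N := N)
        (a := fun i => τ k ((i : ℝ) / N)) (by simp [hτ0]) (by simp [hN'.ne', hτ1])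
        (fun i hi => hτ k _ (hmem i hi))
        (fun i hi => hτm k (hmem i hi.le) (hmem (i + 1) hi) (hstep i))
        (fun i hi s hs => (hosc k _ (hmem i hi.le) _ (hmem (i + 1) hi) s hs).trans_lt (by
          refine lt_of_eq_of_lt ?_ hNδ
          push_cast
          ring))
      exact key.trans (add_le_add le_rfl (mul_le_mul_of_nonneg_left (hL k) hη.le))
  have hz : Tendsto (fun η : ℝ => S + η * L) (nhdsWithin 0 (Ioi 0)) (nhds (S + 0 * L)) :=
    ((continuous_const.add (continuous_id.mul continuous_const)).tendsto (0 : ℝ)).mono_left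
      nhdsWithin_le_nhds
  rw [zero_mul, add_zero] at hz
  exact ge_of_tendsto hz (eventually_mem_nhdsWithin.mono hη)

end Geometric

theorem exists_subseq_tendsto_of_lipschitzWith {X E : Type*} [PseudoMetricSpace X] [CompactSpace X]
    [MetricSpace E] {K : Set E} (hK : IsCompact K) {M : NNReal} {f : ℕ → X → E}
    (hf : ∀ k, LipschitzWith M (f k)) (hfK : ∀ k x, f k x ∈ K) :
    ∃ g : X → E, LipschitzWith M g ∧ (∀ x, g x ∈ K) ∧ ∃ θ : ℕ → ℕ, StrictMono θ ∧
      ∀ x, Tendsto (fun k => f (θ k) x) atTop (nhds (g x)) := by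
  let F : ℕ → BoundedContinuousFunction X E := fun k =>
    BoundedContinuousFunction.mkOfCompact ⟨f k, (hf k).continuous⟩
  have hcpt := BoundedContinuousFunction.arzela_ascoli K hK (range F)
    (by rintro _ x ⟨k, rfl⟩; exact hfK k x)
    (LipschitzWith.uniformEquicontinuous (fun G : range F => (G : X → E)) M
      (by rintro ⟨_, k, rfl⟩; exact hf k)).equicontinuous
  obtain ⟨G, -, θ, hθ, hG⟩ := hcpt.tendsto_subseq fun k => subset_closure (mem_range_self k)
  have hpt : ∀ x, Tendsto (fun k => f (θ k) x) atTop (nhds (G x)) := fun x =>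
    ((continuous_eval_const x).tendsto G).comp hG
  refine ⟨G, LipschitzWith.of_dist_le_mul fun x y => ?_, fun x => ?_, θ, hθ, hpt⟩
  · exact le_of_tendsto' ((hpt x).dist (hpt y)) fun k => (hf (θ k)).dist_le_mul x y
  · exact hK.isClosed.mem_of_tendsto (hpt x) (.of_forall fun k => hfK (θ k) x)

/-- if a minimizing sequence stays in a compact set and has uniformly
bounded lengths, then a (strong) minimizer exists, whose length is at most the
liminf of the lengths of the sequence. -/
theorem statement6 {n : ℕ} (D : Set (Euc n)) (hD : IsOpen D) (hDne : D.Nonempty)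
    (Eset : Set (Euc n)) (hEsub : Eset ⊆ D)
    (hEclosed : ∀ w ∈ D, w ∈ closure Eset → w ∈ Eset)
    (ℓ : Euc n → Euc n → ℝ)
    (hℓcont : ContinuousOn (fun p : Euc n × Euc n => ℓ p.1 p.2) (D ×ˢ Set.univ))
    (hℓnonneg : ∀ x ∈ D, ∀ y : Euc n, 0 ≤ ℓ x y)
    (hℓhom : ∀ x ∈ D, ∀ y : Euc n, ∀ c : ℝ, 0 ≤ c → ℓ x (c • y) = c * ℓ x y)
    (hℓconv : ∀ x ∈ D, ConvexOn ℝ Set.univ (fun y => ℓ x y))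
    (A₁ A₂ : Set (Euc n)) (hA₁sub : A₁ ⊆ Eset) (hA₂sub : A₂ ⊆ Eset)
    (hA₁closed : ∀ w ∈ D, w ∈ closure A₁ → w ∈ A₁)
    (hA₂closed : ∀ w ∈ D, w ∈ closure A₂ → w ∈ A₂)
    (K : Set (Euc n)) (hK : IsCompact K) (hKE : K ⊆ Eset)
    (φ φ' : ℕ → ℝ → Euc n)
    (hAC : ∀ k, GeoAC (φ k) (φ' k))
    (hφK : ∀ k, ∀ t ∈ Set.Icc (0:ℝ) 1, φ k t ∈ K)
    (hφ0 : ∀ k, φ k 0 ∈ A₁) (hφ1 : ∀ k, φ k 1 ∈ A₂)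
    (L : ℝ) (hL : ∀ k, geoLen (φ' k) ≤ L)
    (hmin : Tendsto (fun k => geoAction ℓ (φ k) (φ' k)) atTop
      (nhds (sInf (geoActSet ℓ Eset A₁ A₂)))) :
    ∃ φs φs' : ℝ → Euc n, GeoAC φs φs' ∧ (∀ t ∈ Set.Icc (0:ℝ) 1, φs t ∈ Eset) ∧
      φs 0 ∈ A₁ ∧ φs 1 ∈ A₂ ∧ geoAction ℓ φs φs' = sInf (geoActSet ℓ Eset A₁ A₂) ∧
      geoLen φs' ≤ liminf (fun k => geoLen (φ' k)) atTop := by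
  have hℓ : IsLocalAction D ℓ := ⟨hℓcont, hℓnonneg, hℓhom, hℓconv⟩
  have hKD : K ⊆ D := hKE.trans hEsub
  have h0 : (0 : ℝ) ∈ Icc (0 : ℝ) 1 := by simp
  have h1 : (1 : ℝ) ∈ Icc (0 : ℝ) 1 := by simp
  have hlen : ∀ k, 0 ≤ geoLen (φ' k) := fun k =>
    intervalIntegral.integral_nonneg zero_le_one fun _ _ => norm_nonneg _
  choose τ hτ0 hτ1 hτ hτm hosc using fun k => (hAC k).exists_reparametrization (hL k)
  have hM : 0 ≤ L + 1 := by linarith [(hlen 0).trans (hL 0)]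
  obtain ⟨θ, hθ, hθlen⟩ := (MapClusterPt.liminf (f := atTop) (u := fun k => geoLen (φ' k))
    (isBoundedUnder_of ⟨L, hL⟩).isCoboundedUnder_ge (isBoundedUnder_of ⟨0, hlen⟩)).tendsto_subseq
  have hlip : ∀ k, LipschitzWith ⟨L + 1, hM⟩ fun t : Icc (0 : ℝ) 1 => φ (θ k) (τ (θ k) t) := by
    intro k
    refine LipschitzWith.of_dist_le_mul fun s t => ?_
    wlog hst : s ≤ t generalizing s t
    · rw [dist_comm, dist_comm s]
      exact this t s (le_of_not_ge hst)
    rw [Subtype.dist_eq, dist_comm (s : ℝ), Real.dist_eq,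
      abs_of_nonneg (sub_nonneg.2 (Subtype.coe_le_coe.2 hst))]
    exact hosc (θ k) s s.2 t t.2 _ (right_mem_Icc.2 (hτm (θ k) s.2 t.2 hst))
  obtain ⟨g, hg, hgK, ρ, hρ, hlim⟩ := exists_subseq_tendsto_of_lipschitzWith hK hlip
    fun k t => hφK _ _ (hτ _ _ t.2)
  set f : ℝ → Euc n := fun t => g (projIcc 0 1 zero_le_one t) with hf
  have hflip : LipschitzWith ⟨L + 1, hM⟩ f :=
    (hg.comp (LipschitzWith.projIcc (zero_le_one' ℝ))).weaken (mul_one _).le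
  have hfK : ∀ t ∈ Icc (0 : ℝ) 1, f t ∈ K := fun t _ => hgK _
  have hflim : ∀ t ∈ Icc (0 : ℝ) 1,
      Tendsto (fun k => φ (θ (ρ k)) (τ (θ (ρ k)) t)) atTop (nhds (f t)) := fun t ht => by
    simpa only [hf, projIcc_of_mem zero_le_one ht] using hlim ⟨t, ht⟩
  have hlsc : ∀ {ℓ' : Euc n → Euc n → ℝ} {S : ℝ}, IsLocalAction D ℓ' →
      Tendsto (fun k => geoAction ℓ' (φ (θ (ρ k))) (φ' (θ (ρ k)))) atTop (nhds S) →
      geoAction ℓ' f (deriv f) ≤ S := fun hℓ' hS =>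
    hflip.geoAction_deriv_le hℓ' hD hK hKD hfK (fun k => hAC _) (fun k => hφK _) (fun k => hL _)
      (fun k => hτ0 _) (fun k => hτ1 _) (fun k => hτ _) (fun k => hτm _) (fun k => hosc _)
      hflim hS
  have hf0 : f 0 ∈ A₁ := hA₁closed _ (hKD (hfK 0 h0)) <| mem_closure_of_tendsto (hflim 0 h0)
    (.of_forall fun k => by rw [hτ0]; exact hφ0 _)
  have hf1 : f 1 ∈ A₂ := hA₂closed _ (hKD (hfK 1 h1)) <| mem_closure_of_tendsto (hflim 1 h1)
    (.of_forall fun k => by rw [hτ1]; exact hφ1 _)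
  have hfE : ∀ t ∈ Icc (0 : ℝ) 1, f t ∈ Eset := fun t ht => hKE (hfK t ht)
  refine ⟨f, deriv f, hflip.geoAC, hfE, hf0, hf1, le_antisymm ?_ ?_, ?_⟩
  · exact hlsc hℓ (hmin.comp (hθ.comp hρ).tendsto_atTop)
  · refine csInf_le ⟨0, ?_⟩ ⟨f, deriv f, hflip.geoAC, hfE, hf0, hf1, rfl⟩
    rintro _ ⟨u, v, -, huE, -, -, rfl⟩
    exact intervalIntegral.integral_nonneg zero_le_one fun t ht => hℓnonneg _ (hEsub (huE t ht)) _
  · exact hlsc (isLocalAction_norm D) (hθlen.comp hρ.tendsto_atTop)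
end

section
/- Let D ⊆ ℝⁿ be open, let E ⊆ D be closed in D and satisfy assumption (E), let ℓ be a local action on D, and let A₁, A₂ ⊆ E be closed in D. Write m := inf{S(φ) : φ : [0,1] → E absolutely continuous, φ(0) ∈ A₁, φ(1) ∈ A₂}. Let K ⊆ E be a compact set all of whose points have strong local minimizers, and suppose there is a sequence (φₙ) of absolutely continuous functions [0,1] → K with φₙ(0) ∈ A₁, φₙ(1) ∈ A₂ and S(φₙ) → m. Then the infimum is attained: there exists an absolutely continuous φ* : [0,1] → E with φ*(0) ∈ A₁, φ*(1) ∈ A₂ and S(φ*) = m. -/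
open MeasureTheory Set Filter
open scoped RealInnerProductSpace

/-- Assumption (E): nearby points of `Eset` can be joined by short curves in `Eset`. -/
def GeoAssumpE {n : ℕ} (Eset : Set (Euc n)) : Prop :=
  ∀ x ∈ Eset, ∀ ν > (0:ℝ), ∃ r > (0:ℝ), ∀ w ∈ Metric.closedBall x r ∩ Eset,
    ∃ φ φ' : ℝ → Euc n, GeoAC φ φ' ∧ (∀ t ∈ Set.Icc (0:ℝ) 1, φ t ∈ Eset) ∧
      φ 0 = x ∧ φ 1 = w ∧ geoLen φ' ≤ ν

/-- A point `x ∈ Eset` has strong local minimizers. -/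
def GeoHasStrongLocalMin {n : ℕ} (ℓ : Euc n → Euc n → ℝ) (Eset : Set (Euc n))
    (x : Euc n) : Prop :=
  ∃ r > (0:ℝ), ∃ η > (0:ℝ), ∃ K : Set (Euc n), IsCompact K ∧ K ⊆ Eset ∧
    ∀ x₁ ∈ Metric.closedBall x r ∩ Eset, ∀ x₂ ∈ Metric.closedBall x r ∩ Eset,
      ∃ φ φ' : ℝ → Euc n, GeoAC φ φ' ∧ (∀ t ∈ Set.Icc (0:ℝ) 1, φ t ∈ K) ∧
        φ 0 = x₁ ∧ φ 1 = x₂ ∧ geoLen φ' ≤ η ∧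
        geoAction ℓ φ φ' = sInf (geoActSet ℓ Eset {x₁} {x₂})

/-- A continuous nonnegative integrand on `D` that is positively homogeneous in the velocity. -/
structure IsHomIntegrand {n : ℕ} (ℓ : Euc n → Euc n → ℝ) (D : Set (Euc n)) : Prop where
  cont : ContinuousOn (fun p : Euc n × Euc n => ℓ p.1 p.2) (D ×ˢ Set.univ)
  nonneg : ∀ x ∈ D, ∀ y : Euc n, 0 ≤ ℓ x y
  hom : ∀ x ∈ D, ∀ y : Euc n, ∀ c : ℝ, 0 ≤ c → ℓ x (c • y) = c * ℓ x y

namespace GeoAC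

variable {n : ℕ} {φ φ' : ℝ → Euc n}

lemma intervalIntegrable_s7 (h : GeoAC φ φ') : IntervalIntegrable φ' volume 0 1 :=
  (intervalIntegrable_iff_integrableOn_Icc_of_le zero_le_one).2 h.1

lemma intervalIntegrable_sub (h : GeoAC φ φ') {a b : ℝ} (ha : a ∈ Icc (0:ℝ) 1)
    (hb : b ∈ Icc (0:ℝ) 1) : IntervalIntegrable φ' volume a b := by
  refine h.intervalIntegrable_s7.mono_set ?_
  rw [uIcc_of_le zero_le_one]
  exact uIcc_subset_Icc ha hb

lemma continuousOn_s7 (h : GeoAC φ φ') : ContinuousOn φ (Icc 0 1) := by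
  have h1 : ContinuousOn (fun t => φ 0 + ∫ s in (0:ℝ)..t, φ' s) (Icc 0 1) := by
    have := intervalIntegral.continuousOn_primitive_interval (μ := volume) (f := φ')
      (a := (0:ℝ)) (b := 1) (by rw [uIcc_of_le zero_le_one]; exact h.1)
    rw [uIcc_of_le zero_le_one] at this
    exact continuousOn_const.add this
  exact h1.congr h.2

lemma eq_add_integral (h : GeoAC φ φ') {a b : ℝ} (ha : a ∈ Icc (0:ℝ) 1)
    (hb : b ∈ Icc (0:ℝ) 1) : φ b = φ a + ∫ s in a..b, φ' s := by
  have h0 : (0:ℝ) ∈ Icc (0:ℝ) 1 := ⟨le_rfl, zero_le_one⟩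
  rw [h.2 b hb, h.2 a ha, add_assoc, intervalIntegral.integral_add_adjacent_intervals
    (h.intervalIntegrable_sub h0 ha) (h.intervalIntegrable_sub ha hb)]

/-- Affine reparametrization, possibly constant or orientation reversing. -/
lemma comp_affine (h : GeoAC φ φ') {c d : ℝ} (hd : d ∈ Icc (0:ℝ) 1)
    (hcd : c + d ∈ Icc (0:ℝ) 1) :
    GeoAC (fun t => φ (c * t + d)) (fun t => c • φ' (c * t + d)) := by
  constructor
  · rcases eq_or_ne c 0 with rfl | hc
    · simp
    · rw [← intervalIntegrable_iff_integrableOn_Icc_of_le zero_le_one]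
      have h1 := ((h.intervalIntegrable_sub hd hcd).comp_add_right d).comp_mul_left (c := c)
      have h2 : IntervalIntegrable (fun t => φ' (c * t + d)) volume 0 1 := by
        simpa [hc] using h1
      exact h2.smul c
  · intro t ht
    have hmem : c * t + d ∈ Icc (0:ℝ) 1 := by
      have h3 := convex_Icc (0:ℝ) 1 hd hcd (sub_nonneg.2 ht.2) ht.1 (by ring)
      simp only [smul_eq_mul] at h3
      convert h3 using 1
      ring
    have := h.eq_add_integral (by simpa using hd : c * 0 + d ∈ Icc (0:ℝ) 1) hmem
    simp only [this, intervalIntegral.integral_smul,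
      intervalIntegral.smul_integral_comp_mul_add]

lemma norm_sub_le_geoLen (h : GeoAC φ φ') {t : ℝ} (ht : t ∈ Icc (0:ℝ) 1) :
    ‖φ t - φ 0‖ ≤ geoLen φ' := by
  rw [h.2 t ht, add_sub_cancel_left]
  refine (intervalIntegral.norm_integral_le_integral_norm ht.1).trans ?_
  exact intervalIntegral.integral_mono_interval le_rfl ht.1 ht.2
    (Eventually.of_forall fun _ => norm_nonneg _) h.intervalIntegrable_s7.norm

/-- Concatenation of two curves. -/
lemma trans {ψ ψ' : ℝ → Euc n} (h : GeoAC φ φ') (k : GeoAC ψ ψ') (hjoin : φ 1 = ψ 0) :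
    GeoAC (fun t => if t ≤ 1 / 2 then φ (2 * t) else ψ (2 * t - 1))
      (fun t => if t ≤ 1 / 2 then (2:ℝ) • φ' (2 * t) else (2:ℝ) • ψ' (2 * t - 1)) := by
  have hl : IntervalIntegrable (fun t => (2:ℝ) • φ' (2 * t)) volume 0 (1/2) := by
    have h1 : IntervalIntegrable (fun t => φ' (2 * t)) volume 0 (1/2) := by
      simpa using h.intervalIntegrable_s7.comp_mul_left (c := 2)
    exact h1.smul (2:ℝ)
  have hr : IntervalIntegrable (fun t => (2:ℝ) • ψ' (2 * t - 1)) volume (1/2) 1 := by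
    have h1 : IntervalIntegrable (fun t => ψ' (2 * t - 1)) volume (1/2) 1 := by
      have h2 := (k.intervalIntegrable_s7.comp_add_right (-1)).comp_mul_left (c := 2)
      norm_num [← sub_eq_add_neg] at h2 ⊢
      exact h2
    exact h1.smul (2:ℝ)
  set χ : ℝ → Euc n :=
    fun t => if t ≤ 1 / 2 then (2:ℝ) • φ' (2 * t) else (2:ℝ) • ψ' (2 * t - 1) with hχ
  have hl' : IntervalIntegrable χ volume 0 (1/2) := by
    refine hl.congr fun t ht => ?_
    rw [uIoc_of_le (by norm_num)] at ht
    simp only [hχ, if_pos ht.2]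
  have hr' : IntervalIntegrable χ volume (1/2) 1 := by
    refine hr.congr fun t ht => ?_
    rw [uIoc_of_le (by norm_num)] at ht
    simp only [hχ, if_neg (not_le.2 ht.1)]
  have left : ∀ t ∈ Icc (0:ℝ) (1/2), ∫ s in (0:ℝ)..t, χ s = φ (2 * t) - φ 0 := by
    intro t ht
    have e : ∫ s in (0:ℝ)..t, χ s = ∫ s in (0:ℝ)..t, (2:ℝ) • φ' (2 * s) := by
      refine intervalIntegral.integral_congr fun s hs => ?_
      rw [uIcc_of_le ht.1] at hs
      simp only [hχ, if_pos (hs.2.trans ht.2)]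
    rw [e, intervalIntegral.integral_smul, intervalIntegral.smul_integral_comp_mul_left,
      mul_zero, h.2 (2 * t) ⟨by linarith [ht.1], by linarith [ht.2]⟩, add_sub_cancel_left]
  have right : ∀ t ∈ Icc (1/2:ℝ) 1, ∫ s in (1/2:ℝ)..t, χ s = ψ (2 * t - 1) - ψ 0 := by
    intro t ht
    have e : ∫ s in (1/2:ℝ)..t, χ s = ∫ s in (1/2:ℝ)..t, (2:ℝ) • ψ' (2 * s - 1) := by
      refine intervalIntegral.integral_congr_uIoo fun s hs => ?_
      rw [uIoo_of_le ht.1] at hs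
      simp only [hχ, if_neg (not_le.2 hs.1)]
    rw [e, intervalIntegral.integral_smul, intervalIntegral.smul_integral_comp_mul_sub,
      k.2 (2 * t - 1) ⟨by linarith [ht.1], by linarith [ht.2]⟩, add_sub_cancel_left]
    norm_num
  refine ⟨(intervalIntegrable_iff_integrableOn_Icc_of_le zero_le_one).1 (hl'.trans hr'), ?_⟩
  intro t ht
  have h0 : (0:ℝ) ≤ 1 / 2 := by norm_num
  simp only [if_pos h0, mul_zero]
  by_cases htm : t ≤ 1 / 2
  · rw [if_pos htm, left t ⟨ht.1, htm⟩]
    abel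
  · have htm' := (not_le.1 htm).le
    have hmono : IntervalIntegrable χ volume (1/2) t := by
      refine hr'.mono_set ?_
      rw [uIcc_of_le htm', uIcc_of_le (by norm_num)]
      exact Icc_subset_Icc_right ht.2
    rw [if_neg htm, ← intervalIntegral.integral_add_adjacent_intervals hl' hmono,
      left _ ⟨h0, le_rfl⟩, right t ⟨htm', ht.2⟩]
    norm_num [hjoin]

end GeoAC

namespace IsHomIntegrand

variable {n : ℕ} {ℓ : Euc n → Euc n → ℝ} {D : Set (Euc n)}

lemma exists_le_mul_norm (hℓ : IsHomIntegrand ℓ D) {Q : Set (Euc n)} (hQ : IsCompact Q)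
    (hQD : Q ⊆ D) : ∃ C : ℝ, 0 ≤ C ∧ ∀ x ∈ Q, ∀ y, ℓ x y ≤ C * ‖y‖ := by
  obtain ⟨C, hC⟩ := ((hQ.prod (isCompact_sphere (0 : Euc n) 1)).image_of_continuousOn
    (hℓ.cont.mono (prod_mono hQD (subset_univ _)))).bddAbove
  refine ⟨max C 0, le_max_right _ _, fun x hx y => ?_⟩
  rcases eq_or_ne y 0 with rfl | hy
  · have := hℓ.hom x (hQD hx) 0 0 le_rfl
    simp only [smul_zero, zero_mul] at this
    simp [this]
  · have hy' : ‖y‖ ≠ 0 := norm_ne_zero_iff.2 hy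
    have h1 : ℓ x (‖y‖⁻¹ • y) ≤ C := by
      refine hC ⟨(x, ‖y‖⁻¹ • y), ⟨hx, ?_⟩, rfl⟩
      simp [norm_smul, hy']
    have h2 := hℓ.hom x (hQD hx) (‖y‖⁻¹ • y) ‖y‖ (norm_nonneg y)
    rw [smul_smul, mul_inv_cancel₀ hy', one_smul] at h2
    rw [h2, mul_comm]
    exact mul_le_mul_of_nonneg_right (h1.trans (le_max_left _ _)) (norm_nonneg y)

lemma intervalIntegrable_s7 (hℓ : IsHomIntegrand ℓ D) (hD : IsOpen D) {φ φ' : ℝ → Euc n}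
    (h : GeoAC φ φ') (hφ : ∀ t ∈ Icc (0:ℝ) 1, φ t ∈ D) :
    IntervalIntegrable (fun t => ℓ (φ t) (φ' t)) volume 0 1 := by
  rw [intervalIntegrable_iff_integrableOn_Icc_of_le zero_le_one]
  obtain ⟨C, -, hC⟩ := hℓ.exists_le_mul_norm (isCompact_Icc.image_of_continuousOn h.continuousOn_s7)
    (image_subset_iff.2 hφ)
  refine Integrable.mono' (h.1.norm.const_mul C) ?_ ?_
  · classical
    have hmeas : Measurable ((D ×ˢ univ : Set (Euc n × Euc n)).piecewise
        (fun p => ℓ p.1 p.2) (fun _ => 0)) :=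
      hℓ.cont.measurable_piecewise continuousOn_const (hD.prod isOpen_univ).measurableSet
    have hpair : AEMeasurable (fun t => (φ t, φ' t)) (volume.restrict (Icc 0 1)) :=
      (h.continuousOn_s7.aemeasurable measurableSet_Icc).prodMk h.1.aemeasurable
    refine ((hmeas.comp_aemeasurable hpair).congr ?_).aestronglyMeasurable
    filter_upwards [ae_restrict_mem measurableSet_Icc] with t ht
    simp [hφ t ht]
  · filter_upwards [ae_restrict_mem measurableSet_Icc] with t ht
    rw [Real.norm_of_nonneg (hℓ.nonneg _ (hφ t ht) _)]
    exact hC _ ⟨t, ht, rfl⟩ _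

lemma geoAction_nonneg (hℓ : IsHomIntegrand ℓ D) {φ φ' : ℝ → Euc n}
    (hφ : ∀ t ∈ Icc (0:ℝ) 1, φ t ∈ D) : 0 ≤ geoAction ℓ φ φ' :=
  intervalIntegral.integral_nonneg zero_le_one fun t ht => hℓ.nonneg _ (hφ t ht) _

lemma nonneg_of_mem (hℓ : IsHomIntegrand ℓ D) {C A B : Set (Euc n)} (hC : C ⊆ D) {s : ℝ}
    (hs : s ∈ geoActSet ℓ C A B) : 0 ≤ s := by
  obtain ⟨φ, φ', -, hφ, -, -, rfl⟩ := hs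
  exact hℓ.geoAction_nonneg fun t ht => hC (hφ t ht)

lemma sInf_le_of_mem (hℓ : IsHomIntegrand ℓ D) {C A B : Set (Euc n)} (hC : C ⊆ D) {s : ℝ}
    (hs : s ∈ geoActSet ℓ C A B) : sInf (geoActSet ℓ C A B) ≤ s :=
  csInf_le ⟨0, fun _ => hℓ.nonneg_of_mem hC⟩ hs

lemma integral_mem (hℓ : IsHomIntegrand ℓ D) {C : Set (Euc n)} (hC : C ⊆ D)
    {φ φ' : ℝ → Euc n} (h : GeoAC φ φ') {a b : ℝ} (ha : 0 ≤ a) (hab : a ≤ b) (hb : b ≤ 1)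
    (hφ : ∀ t ∈ Icc a b, φ t ∈ C) :
    ∫ t in a..b, ℓ (φ t) (φ' t) ∈ geoActSet ℓ C {φ a} {φ b} := by
  have hmem : ∀ t ∈ Icc (0:ℝ) 1, (b - a) * t + a ∈ Icc a b := fun t ht =>
    ⟨by nlinarith [ht.1], by nlinarith [ht.2]⟩
  refine ⟨_, _, h.comp_affine (c := b - a) (d := a) ⟨ha, hab.trans hb⟩
    ⟨by linarith, by linarith⟩, fun t ht => hφ _ (hmem t ht), by simp, by simp, ?_⟩
  have e : geoAction ℓ (fun t => φ ((b - a) * t + a)) (fun t => (b - a) • φ' ((b - a) * t + a))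
      = ∫ t in (0:ℝ)..1, (b - a) * ℓ (φ ((b - a) * t + a)) (φ' ((b - a) * t + a)) := by
    refine intervalIntegral.integral_congr fun t ht => ?_
    rw [uIcc_of_le zero_le_one] at ht
    exact hℓ.hom _ (hC (hφ _ (hmem t ht))) _ _ (sub_nonneg.2 hab)
  rw [e, intervalIntegral.integral_const_mul,
    intervalIntegral.mul_integral_comp_mul_add (f := fun t => ℓ (φ t) (φ' t))]
  simp

lemma add_mem (hℓ : IsHomIntegrand ℓ D) (hD : IsOpen D) {C : Set (Euc n)} (hC : C ⊆ D)
    {x y z : Euc n} {s t : ℝ} (hs : s ∈ geoActSet ℓ C {x} {y}) (ht : t ∈ geoActSet ℓ C {y} {z}) :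
    s + t ∈ geoActSet ℓ C {x} {z} := by
  obtain ⟨φ, φ', hac, hφ, h0, h1, rfl⟩ := hs
  obtain ⟨ψ, ψ', kac, hψ, k0, k1, rfl⟩ := ht
  simp only [mem_singleton_iff] at h0 h1 k0 k1
  have hχ := hac.trans kac (h1.trans k0.symm)
  have hin : ∀ t ∈ Icc (0:ℝ) 1, (if t ≤ 1 / 2 then φ (2 * t) else ψ (2 * t - 1)) ∈ C := by
    intro t ht
    split_ifs with h
    · exact hφ _ ⟨by linarith [ht.1], by linarith⟩
    · exact hψ _ ⟨by linarith, by linarith [ht.2]⟩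
  refine ⟨_, _, hχ, hin, by simpa using h0, ?_, ?_⟩
  · norm_num
    exact k1
  have hint := hℓ.intervalIntegrable_s7 hD hχ fun t ht => hC (hin t ht)
  have hsub : ∀ {a b : ℝ}, a ∈ Icc (0:ℝ) 1 → b ∈ Icc (0:ℝ) 1 → uIcc a b ⊆ uIcc (0:ℝ) 1 := by
    intro a b ha hb
    rw [uIcc_of_le zero_le_one]
    exact uIcc_subset_Icc ha hb
  have hhalf : (1/2:ℝ) ∈ Icc (0:ℝ) 1 := by constructor <;> norm_num
  unfold geoAction
  rw [← intervalIntegral.integral_add_adjacent_intervals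
    (hint.mono_set (hsub ⟨le_rfl, zero_le_one⟩ hhalf))
    (hint.mono_set (hsub hhalf ⟨zero_le_one, le_rfl⟩))]
  congr 1
  · have e : ∀ t ∈ uIcc (0:ℝ) (1/2), ℓ (if t ≤ 1 / 2 then φ (2 * t) else ψ (2 * t - 1))
        (if t ≤ 1 / 2 then (2:ℝ) • φ' (2 * t) else (2:ℝ) • ψ' (2 * t - 1))
        = 2 * ℓ (φ (2 * t)) (φ' (2 * t)) := by
      intro t ht
      rw [uIcc_of_le (by norm_num)] at ht
      rw [if_pos ht.2, if_pos ht.2]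
      exact hℓ.hom _ (hC (hφ _ ⟨by linarith [ht.1], by linarith [ht.2]⟩)) _ _ zero_le_two
    rw [intervalIntegral.integral_congr e, intervalIntegral.integral_const_mul,
      intervalIntegral.mul_integral_comp_mul_left (f := fun t => ℓ (φ t) (φ' t))]
    norm_num
  · have e : ∀ t ∈ uIoo (1/2:ℝ) 1, ℓ (if t ≤ 1 / 2 then φ (2 * t) else ψ (2 * t - 1))
        (if t ≤ 1 / 2 then (2:ℝ) • φ' (2 * t) else (2:ℝ) • ψ' (2 * t - 1))
        = 2 * ℓ (ψ (2 * t - 1)) (ψ' (2 * t - 1)) := by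
      intro t ht
      rw [uIoo_of_le (by norm_num)] at ht
      rw [if_neg (not_le.2 ht.1), if_neg (not_le.2 ht.1)]
      exact hℓ.hom _ (hC (hψ _ ⟨by linarith [ht.1], by linarith [ht.2]⟩)) _ _ zero_le_two
    rw [intervalIntegral.integral_congr_uIoo e, intervalIntegral.integral_const_mul,
      intervalIntegral.mul_integral_comp_mul_sub (f := fun t => ℓ (ψ t) (ψ' t))]
    norm_num

/-- Under assumption (E), nearby points are joined in both directions by curves of small action. -/
lemma exists_small_action (hℓ : IsHomIntegrand ℓ D) (hD : IsOpen D) {C : Set (Euc n)}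
    (hC : C ⊆ D) (hE : GeoAssumpE C) {x : Euc n} (hx : x ∈ C) {ε : ℝ} (hε : 0 < ε) :
    ∃ r > (0:ℝ), ∀ w ∈ Metric.closedBall x r ∩ C,
      (∃ s ∈ geoActSet ℓ C {x} {w}, s ≤ ε) ∧ ∃ s ∈ geoActSet ℓ C {w} {x}, s ≤ ε := by
  obtain ⟨ρ, hρ, hρD⟩ := Metric.nhds_basis_closedBall.mem_iff.1 (hD.mem_nhds (hC hx))
  obtain ⟨c, hc0, hc⟩ := hℓ.exists_le_mul_norm (isCompact_closedBall x ρ) hρD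
  obtain ⟨r, hr, H⟩ := hE x hx (min ρ (ε / (c + 1))) (by positivity)
  refine ⟨r, hr, fun w hw => ?_⟩
  obtain ⟨φ, φ', hac, hφ, h0, h1, hlen⟩ := H w hw
  have hball : ∀ t ∈ Icc (0:ℝ) 1, φ t ∈ Metric.closedBall x ρ := by
    intro t ht
    rw [mem_closedBall_iff_norm, ← h0]
    exact (hac.norm_sub_le_geoLen ht).trans (hlen.trans (min_le_left _ _))
  have hbound : ∀ {ψ ψ' : ℝ → Euc n}, GeoAC ψ ψ' → (∀ t ∈ Icc (0:ℝ) 1, ψ t ∈ C) →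
      (∀ t ∈ Icc (0:ℝ) 1, ψ t ∈ Metric.closedBall x ρ) → geoLen ψ' = geoLen φ' →
      geoAction ℓ ψ ψ' ≤ ε := by
    intro ψ ψ' kac kC kball klen
    have h2 : geoAction ℓ ψ ψ' ≤ c * geoLen ψ' := by
      unfold geoAction geoLen
      rw [← intervalIntegral.integral_const_mul]
      exact intervalIntegral.integral_mono_on zero_le_one
        (hℓ.intervalIntegrable_s7 hD kac fun t ht => hC (kC t ht))
        (kac.intervalIntegrable_s7.norm.const_mul c) fun t ht => hc _ (kball t ht) _
    have h3 : geoLen ψ' ≤ ε / (c + 1) := klen ▸ hlen.trans (min_le_right _ _)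
    calc geoAction ℓ ψ ψ' ≤ c * (ε / (c + 1)) := h2.trans (mul_le_mul_of_nonneg_left h3 hc0)
      _ ≤ (c + 1) * (ε / (c + 1)) := by gcongr; linarith
      _ = ε := by field_simp
  have hrev : ∀ t ∈ Icc (0:ℝ) 1, -1 * t + 1 ∈ Icc (0:ℝ) 1 := fun t ht =>
    ⟨by linarith [ht.2], by linarith [ht.1]⟩
  have hac' := hac.comp_affine (c := -1) (d := 1) ⟨zero_le_one, le_rfl⟩
    ⟨by norm_num, by norm_num⟩
  refine ⟨⟨_, ⟨φ, φ', hac, hφ, h0, h1, rfl⟩, hbound hac hφ hball rfl⟩,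
    ⟨_, ⟨_, _, hac', fun t ht => hφ _ (hrev t ht), by simpa using h1, by simpa using h0, rfl⟩,
      hbound hac' (fun t ht => hφ _ (hrev t ht)) (fun t ht => hball _ (hrev t ht)) ?_⟩⟩
  unfold geoLen
  have := intervalIntegral.integral_comp_sub_left (fun t => ‖φ' t‖) (a := 0) (b := 1) 1
  simpa [norm_smul, neg_add_eq_sub] using this

/-- The minimal action between two points is lower semicontinuous. -/
lemma sInf_le_of_tendsto (hℓ : IsHomIntegrand ℓ D) (hD : IsOpen D) {C : Set (Euc n)}
    (hC : C ⊆ D) (hE : GeoAssumpE C) {ι : Type*} {l : Filter ι} [l.NeBot] {x z : Euc n} {σ : ℝ}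
    {u v : ι → Euc n} {s : ι → ℝ} (hx : x ∈ C) (hz : z ∈ C)
    (hmem : ∀ᶠ k in l, s k ∈ geoActSet ℓ C {u k} {v k})
    (hu : Tendsto u l (nhds x)) (hv : Tendsto v l (nhds z)) (hs : Tendsto s l (nhds σ)) :
    sInf (geoActSet ℓ C {x} {z}) ≤ σ := by
  refine le_of_forall_pos_le_add fun ε hε => ?_
  have hε3 : 0 < ε / 3 := by positivity
  obtain ⟨r, hr, hxr⟩ := hℓ.exists_small_action hD hC hE hx hε3
  obtain ⟨q, hq, hzq⟩ := hℓ.exists_small_action hD hC hE hz hε3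
  obtain ⟨k, hk, huk, hvk, hsk⟩ := (hmem.and ((hu.eventually (Metric.closedBall_mem_nhds x hr)).and
    ((hv.eventually (Metric.closedBall_mem_nhds z hq)).and
      (hs.eventually (eventually_lt_nhds (lt_add_of_pos_right σ hε3)))))).exists
  have hends : u k ∈ C ∧ v k ∈ C := by
    obtain ⟨φ, φ', -, hφ, h0, h1, -⟩ := hk
    rw [mem_singleton_iff] at h0 h1
    exact ⟨h0 ▸ hφ 0 ⟨le_rfl, zero_le_one⟩, h1 ▸ hφ 1 ⟨zero_le_one, le_rfl⟩⟩
  obtain ⟨⟨a, ha, haε⟩, -⟩ := hxr (u k) ⟨huk, hends.1⟩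
  obtain ⟨-, ⟨b, hb, hbε⟩⟩ := hzq (v k) ⟨hvk, hends.2⟩
  have := hℓ.sInf_le_of_mem hC (hℓ.add_mem hD hC (hℓ.add_mem hD hC ha hk) hb)
  linarith

/-- Cutting a curve at the last time it visits a closed set of a finite closed cover. -/
lemma exists_split (hℓ : IsHomIntegrand ℓ D) (hD : IsOpen D) {K : Set (Euc n)} (hK : IsClosed K)
    (hKD : K ⊆ D) {ι : Type*} [DecidableEq ι] {B : ι → Set (Euc n)} (hB : ∀ i, IsClosed (B i))
    {F : Finset ι} {i : ι} {x y : Euc n} {s : ℝ}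
    (hs : s ∈ geoActSet ℓ (K ∩ ⋃ j ∈ F, B j) {x} {y}) (hx : x ∈ B i) :
    ∃ z ∈ B i ∩ K, ∃ σ τ : ℝ, 0 ≤ σ ∧ 0 ≤ τ ∧ σ + τ = s ∧ σ ∈ geoActSet ℓ K {x} {z} ∧
      (y = z ∨ τ ∈ geoActSet ℓ (K ∩ ⋃ j ∈ F.erase i, B j) {z} {y}) := by
  obtain ⟨φ, φ', hac, hφ, h0, h1, rfl⟩ := hs
  rw [mem_singleton_iff] at h0 h1
  have hcl : IsClosed (Icc (0:ℝ) 1 ∩ φ ⁻¹' B i) :=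
    hac.continuousOn_s7.preimage_isClosed_of_isClosed isClosed_Icc (hB i)
  obtain ⟨T, ⟨hT, hTB⟩, hTmax⟩ := (isCompact_Icc.of_isClosed_subset hcl
    inter_subset_left).exists_isGreatest ⟨0, ⟨le_rfl, zero_le_one⟩, by
      rw [mem_preimage, h0]; exact hx⟩
  have hφK : ∀ t ∈ Icc (0:ℝ) 1, φ t ∈ K := fun t ht => (hφ t ht).1
  have hint := hℓ.intervalIntegrable_s7 hD hac fun t ht => hKD (hφK t ht)
  have hl := hℓ.integral_mem hKD hac le_rfl hT.1 hT.2 fun t ht => hφK t ⟨ht.1, ht.2.trans hT.2⟩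
  have hr := hℓ.integral_mem hKD hac hT.1 hT.2 le_rfl fun t ht => hφK t ⟨hT.1.trans ht.1, ht.2⟩
  refine ⟨φ T, ⟨hTB, hφK T hT⟩, _, _, hℓ.nonneg_of_mem hKD hl, hℓ.nonneg_of_mem hKD hr, ?_,
    h0 ▸ hl, ?_⟩
  · refine intervalIntegral.integral_add_adjacent_intervals (hint.mono_set ?_) (hint.mono_set ?_)
    · rw [uIcc_of_le zero_le_one, uIcc_of_le hT.1]
      exact Icc_subset_Icc_right hT.2
    · rw [uIcc_of_le zero_le_one, uIcc_of_le hT.2]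
      exact Icc_subset_Icc_left hT.1
  · rcases hT.2.eq_or_lt with hT1 | hT1
    · exact Or.inl (by rw [← h1, hT1])
    right
    rw [← h1]
    refine hℓ.integral_mem (inter_subset_left.trans hKD) hac hT.1 hT.2 le_rfl ?_
    have hclosed : IsClosed (K ∩ ⋃ j ∈ F.erase i, B j) :=
      hK.inter (isClosed_biUnion_finset fun j _ => hB j)
    have hIoc : MapsTo φ (Ioc T 1) (K ∩ ⋃ j ∈ F.erase i, B j) := by
      intro t ht
      have htI : t ∈ Icc (0:ℝ) 1 := ⟨hT.1.trans ht.1.le, ht.2⟩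
      refine ⟨hφK t htI, ?_⟩
      obtain ⟨j, hj, hjt⟩ := mem_iUnion₂.1 (hφ t htI).2
      refine mem_iUnion₂.2 ⟨j, Finset.mem_erase.2 ⟨?_, hj⟩, hjt⟩
      rintro rfl
      exact (hTmax ⟨htI, hjt⟩).not_gt ht.1
    have hcont : ContinuousOn φ (closure (Ioc T 1)) := by
      rw [closure_Ioc hT1.ne]
      exact hac.continuousOn_s7.mono (Icc_subset_Icc_left hT.1)
    have := hIoc.closure_of_continuousOn hcont
    rw [closure_Ioc hT1.ne, hclosed.closure_eq] at this
    exact this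

/-- If every two points of each set of a finite closed cover are joined by a minimizer, then limits
of curves inside the cover can be realized without increasing the action. -/
lemma exists_le_of_tendsto (hℓ : IsHomIntegrand ℓ D) (hD : IsOpen D) {C : Set (Euc n)}
    (hC : C ⊆ D) (hE : GeoAssumpE C) {K : Set (Euc n)} (hK : IsCompact K) (hKC : K ⊆ C)
    {ι : Type*} [DecidableEq ι] {B : ι → Set (Euc n)} (hB : ∀ i, IsClosed (B i)) {κ : Type*}
    (U : Ultrafilter κ) (F : Finset ι)
    (hmin : ∀ i ∈ F, ∀ p ∈ B i ∩ C, ∀ q ∈ B i ∩ C,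
      sInf (geoActSet ℓ C {p} {q}) ∈ geoActSet ℓ C {p} {q})
    {x y : Euc n} {s : ℝ} {u v : κ → Euc n} {a : κ → ℝ}
    (hmem : ∀ᶠ k in U, a k ∈ geoActSet ℓ (K ∩ ⋃ j ∈ F, B j) {u k} {v k})
    (hu : Tendsto u U (nhds x)) (hv : Tendsto v U (nhds y)) (ha : Tendsto a U (nhds s)) :
    ∃ s' ∈ geoActSet ℓ C {x} {y}, s' ≤ s := by
  induction hF : F.card generalizing F x s u a with
  | zero =>
    rw [Finset.card_eq_zero] at hF
    subst hF
    obtain ⟨k, φ, φ', -, hφ, -⟩ := hmem.exists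
    simpa using hφ 0 ⟨le_rfl, zero_le_one⟩
  | succ N ih =>
    have hKD := hKC.trans hC
    have huK : ∀ᶠ k in U, u k ∈ K ∧ ∃ i ∈ F, u k ∈ B i := by
      filter_upwards [hmem] with k ⟨φ, φ', _, hφ, h0, _⟩
      rw [mem_singleton_iff] at h0
      simpa [h0] using hφ 0 ⟨le_rfl, zero_le_one⟩
    have hxK : x ∈ K := hK.isClosed.mem_of_tendsto hu (huK.mono fun k h => h.1)
    obtain ⟨i, hi, hiu⟩ : ∃ i ∈ F, ∀ᶠ k in U, u k ∈ B i := by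
      have := (Ultrafilter.finite_biUnion_mem_iff (f := U) F.finite_toSet
        (s := fun i => {k | u k ∈ B i})).1 (by
          filter_upwards [huK] with k hk
          simpa using hk.2)
      exact this
    have hxB : x ∈ B i := (hB i).mem_of_tendsto hu hiu
    have hsplit := (hmem.and hiu).mono fun k h =>
      hℓ.exists_split hD hK.isClosed hKD hB h.1 h.2
    obtain ⟨w, hw⟩ := hsplit.choice
    obtain ⟨σ, hσ⟩ := (hw.mono fun k h => h.2).choice
    obtain ⟨τ, hτ⟩ := hσ.choice
    obtain ⟨z, hzK, hz⟩ := hK.ultrafilter_le_nhds (U.map w)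
      (le_principal_iff.2 (hw.mono fun k h => h.1.2))
    have hwz : Tendsto w U (nhds z) := hz
    have hzB : z ∈ B i := (hB i).mem_of_tendsto hwz (hw.mono fun k h => h.1.1)
    have hlt := ha.eventually (eventually_lt_nhds (lt_add_one s))
    obtain ⟨σ₀, -, hσ₀⟩ := (isCompact_Icc (a := (0:ℝ)) (b := s + 1)).ultrafilter_le_nhds (U.map σ)
      (le_principal_iff.2 ((hτ.and hlt).mono fun k h => ⟨h.1.1, by linarith [h.1.2.1, h.1.2.2.1, h.2]⟩))
    have hσ₀ : Tendsto σ U (nhds σ₀) := hσ₀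
    have hτ₀ : Tendsto τ U (nhds (s - σ₀)) :=
      (ha.sub hσ₀).congr' (hτ.mono fun k h => by linarith [h.2.2.1])
    have hτnn : 0 ≤ s - σ₀ := ge_of_tendsto hτ₀ (hτ.mono fun k h => h.2.1)
    have hfirst : sInf (geoActSet ℓ C {x} {z}) ≤ σ₀ :=
      hℓ.sInf_le_of_tendsto hD hC hE (hKC hxK) (hKC hzK)
        (hτ.mono fun k ⟨_, _, _, ⟨φ, φ', hac, hφ, h⟩, _⟩ =>
          ⟨φ, φ', hac, fun t ht => hKC (hφ t ht), h⟩) hu hwz hσ₀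
    have hxz := hmin i hi x ⟨hxB, hKC hxK⟩ z ⟨hzB, hKC hzK⟩
    rcases Ultrafilter.eventually_or.1 (hτ.mono fun k h => h.2.2.2.2) with hvw | hrest
    · obtain rfl : y = z := tendsto_nhds_unique hv (hwz.congr' (hvw.mono fun k h => h.symm))
      exact ⟨_, hxz, by linarith⟩
    · obtain ⟨t, ht, hts⟩ := ih (F.erase i) (fun j hj => hmin j (Finset.mem_of_mem_erase hj))
        hrest hwz hτ₀ (by rw [Finset.card_erase_of_mem hi, hF]; rfl)
      exact ⟨_, hℓ.add_mem hD hC hxz ht, by linarith⟩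

end IsHomIntegrand

/-- existence theorem.  If a minimizing sequence stays in a compact
set all of whose points have strong local minimizers, then a strong minimizer
from `A₁` to `A₂` exists. -/
theorem statement7 {n : ℕ} (D : Set (Euc n)) (hD : IsOpen D) (hDne : D.Nonempty)
    (Eset : Set (Euc n)) (hEsub : Eset ⊆ D)
    (hEclosed : ∀ w ∈ D, w ∈ closure Eset → w ∈ Eset)
    (hAssumpE : GeoAssumpE Eset)
    (ℓ : Euc n → Euc n → ℝ)
    (hℓcont : ContinuousOn (fun p : Euc n × Euc n => ℓ p.1 p.2) (D ×ˢ Set.univ))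
    (hℓnonneg : ∀ x ∈ D, ∀ y : Euc n, 0 ≤ ℓ x y)
    (hℓhom : ∀ x ∈ D, ∀ y : Euc n, ∀ c : ℝ, 0 ≤ c → ℓ x (c • y) = c * ℓ x y)
    (hℓconv : ∀ x ∈ D, ConvexOn ℝ Set.univ (fun y => ℓ x y))
    (A₁ A₂ : Set (Euc n)) (hA₁sub : A₁ ⊆ Eset) (hA₂sub : A₂ ⊆ Eset)
    (hA₁closed : ∀ w ∈ D, w ∈ closure A₁ → w ∈ A₁)
    (hA₂closed : ∀ w ∈ D, w ∈ closure A₂ → w ∈ A₂)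
    (K : Set (Euc n)) (hK : IsCompact K) (hKE : K ⊆ Eset)
    (hKmin : ∀ x ∈ K, GeoHasStrongLocalMin ℓ Eset x)
    (φ φ' : ℕ → ℝ → Euc n)
    (hAC : ∀ k, GeoAC (φ k) (φ' k))
    (hφK : ∀ k, ∀ t ∈ Set.Icc (0:ℝ) 1, φ k t ∈ K)
    (hφ0 : ∀ k, φ k 0 ∈ A₁) (hφ1 : ∀ k, φ k 1 ∈ A₂)
    (hmin : Tendsto (fun k => geoAction ℓ (φ k) (φ' k)) atTop
      (nhds (sInf (geoActSet ℓ Eset A₁ A₂)))) :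
    ∃ φs φs' : ℝ → Euc n, GeoAC φs φs' ∧ (∀ t ∈ Set.Icc (0:ℝ) 1, φs t ∈ Eset) ∧
      φs 0 ∈ A₁ ∧ φs 1 ∈ A₂ ∧ geoAction ℓ φs φs' = sInf (geoActSet ℓ Eset A₁ A₂) := by
  classical
  have hℓ : IsHomIntegrand ℓ D := ⟨hℓcont, hℓnonneg, hℓhom⟩
  choose! r hr hloc using hKmin
  obtain ⟨F, hFK, hF⟩ := hK.elim_nhds_subcover (fun x => Metric.closedBall x (r x))
    fun x hx => Metric.closedBall_mem_nhds x (hr x hx)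
  have hpt : ∀ i ∈ F, ∀ p ∈ Metric.closedBall i (r i) ∩ Eset,
      ∀ q ∈ Metric.closedBall i (r i) ∩ Eset,
      sInf (geoActSet ℓ Eset {p} {q}) ∈ geoActSet ℓ Eset {p} {q} := by
    intro i hi p hp q hq
    obtain ⟨η, -, Q, -, hQE, H⟩ := hloc i (hFK i hi)
    obtain ⟨ψ, ψ', hac, hψ, h0, h1, -, hact⟩ := H p hp q hq
    exact ⟨ψ, ψ', hac, fun t ht => hQE (hψ t ht), h0, h1, hact.symm⟩
  let U : Ultrafilter ℕ := Ultrafilter.of atTop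
  have hU : (U : Filter ℕ) ≤ atTop := Ultrafilter.of_le atTop
  have hlim : ∀ t ∈ Icc (0:ℝ) 1, ∃ x ∈ K, Tendsto (fun k => φ k t) U (nhds x) := fun t ht =>
    hK.ultrafilter_le_nhds (U.map fun k => φ k t)
      (le_principal_iff.2 (mem_map.2 (univ_mem' fun k => hφK k t ht)))
  obtain ⟨x, hxK, hx⟩ := hlim 0 ⟨le_rfl, zero_le_one⟩
  obtain ⟨y, hyK, hy⟩ := hlim 1 ⟨zero_le_one, le_rfl⟩
  obtain ⟨s, ⟨ψ, ψ', hac, hψ, h0, h1, rfl⟩, hs⟩ := hℓ.exists_le_of_tendsto hD hEsub hAssumpE hK hKE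
    (fun i => Metric.isClosed_closedBall) U F hpt
    (Eventually.of_forall fun k => ⟨φ k, φ' k, hAC k,
      fun t ht => ⟨hφK k t ht, hF (hφK k t ht)⟩, rfl, rfl, rfl⟩) hx hy (hmin.mono_left hU)
  rw [mem_singleton_iff] at h0 h1
  have hxA : x ∈ A₁ := hA₁closed x (hEsub (hKE hxK))
    (mem_closure_of_tendsto hx (Eventually.of_forall hφ0))
  have hyA : y ∈ A₂ := hA₂closed y (hEsub (hKE hyK))
    (mem_closure_of_tendsto hy (Eventually.of_forall hφ1))
  exact ⟨ψ, ψ', hac, hψ, h0 ▸ hxA, h1 ▸ hyA, le_antisymm hs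
    (hℓ.sInf_le_of_mem hEsub ⟨ψ, ψ', hac, hψ, h0 ▸ hxA, h1 ▸ hyA, rfl⟩)⟩
end
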